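/- Let f be a function of critical growth on 𝔹² satisfying in addition conditions (C5) and (C6). Then sup{ c² : c ≥ 0 and sup{ ∫_B f(x, c·u(x)) u(x) dv_g : u an H¹(𝔹²)-function with ‖u‖ ≤ 1 } < ∞ } = 4π/λ. -/

import Mathlib

open MeasureTheory Real Set Filter

noncomputable section

/-- Points of the plane. -/
abbrev Pt := EuclideanSpace ℝ (Fin 2)

/-- The open unit disc `B = {x ∈ ℝ² : |x| < 1}`. -/
def B : Set Pt := Metric.ball 0 1

/-- The density of the hyperbolic volume measure `dv_g = (2/(1-|x|²))² dx`. -/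
def dens (x : Pt) : ℝ := (2 / (1 - ‖x‖ ^ 2)) ^ 2

/-- Integral with respect to the hyperbolic volume measure on `B`. -/
def hInt (φ : Pt → ℝ) : ℝ := ∫ x in B, φ x * dens x

/-- Integrability with respect to the hyperbolic volume measure on `B`. -/
def HIntegrable (φ : Pt → ℝ) : Prop := IntegrableOn (fun x => φ x * dens x) B volume

/-- The squared Euclidean Dirichlet norm `‖u‖² = ∫_B |∇u|² dx` (which equals the
hyperbolic Dirichlet energy by conformal invariance). -/
def enormSq (u : Pt → ℝ) : ℝ := ∫ x in B, ‖gradient u x‖ ^ 2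

/-- `u` is an `H¹(𝔹²)`-function: differentiable on `B`, with finite Dirichlet
energy and finite hyperbolic `L²` norm. -/
def IsH1 (u : Pt → ℝ) : Prop :=
  DifferentiableOn ℝ u B ∧
  IntegrableOn (fun x => ‖gradient u x‖ ^ 2) B volume ∧
  HIntegrable (fun x => (u x) ^ 2)

/-- `u` is an `H¹_R(𝔹²)`-function: an `H¹(𝔹²)`-function which is radial. -/
def IsH1R (u : Pt → ℝ) : Prop :=
  IsH1 u ∧ ∀ x y : Pt, ‖x‖ = ‖y‖ → u x = u y

/-- The nonlinearity `f(x,t) = h(x,t)(e^{λt²} - 1)`. -/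
def fn (lam : ℝ) (h : Pt → ℝ → ℝ) (x : Pt) (t : ℝ) : ℝ :=
  h x t * (Real.exp (lam * t ^ 2) - 1)

/-- The primitive `F(x,t) = ∫₀^t f(x,s) ds`. -/
def Fn (lam : ℝ) (h : Pt → ℝ → ℝ) (x : Pt) (t : ℝ) : ℝ :=
  ∫ s in (0 : ℝ)..t, fn lam h x s

/-- The functional `I_λ(u) = (1/2)∫_B f(x,u)u dv_g - ∫_B F(x,u) dv_g`. -/
def Ilam (lam : ℝ) (h : Pt → ℝ → ℝ) (u : Pt → ℝ) : ℝ :=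
  (1 / 2) * hInt (fun x => fn lam h x (u x) * u x) - hInt (fun x => Fn lam h x (u x))

/-- `f(x,t) = h(x,t)(e^{λt²} - 1)` is a function of critical growth on `𝔹²`. -/
structure CriticalGrowth (lam : ℝ) (h : Pt → ℝ → ℝ) : Prop where
  lam_pos : 0 < lam
  h_C1 : ContDiff ℝ 1 (Function.uncurry h)
  f_pos : ∀ x ∈ B, ∀ t : ℝ, 0 < t → 0 < fn lam h x t
  f_odd : ∀ x ∈ B, ∀ t : ℝ, fn lam h x (-t) = -fn lam h x t
  /-- (C1), first part: `h` is bounded on `B × [-L, L]` for every `L > 0`. -/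
  h_bdd : ∀ L : ℝ, 0 < L → ∃ C : ℝ, ∀ x ∈ B, ∀ t : ℝ, |t| ≤ L → |h x t| ≤ C
  /-- (C1), second part: `sup_{x ∈ B} |h(x,t)| ≤ C tᵃ` near `t = 0`. -/
  h_zero : ∃ a C δ : ℝ, 0 < a ∧ 0 < C ∧ 0 < δ ∧
    ∀ x ∈ B, ∀ t : ℝ, 0 < t → t < δ → |h x t| ≤ C * t ^ a
  /-- (C2): `∂f/∂t (x,t) > f(x,t)/t` for `t > 0`. -/
  f_super : ∀ x ∈ B, ∀ t : ℝ, 0 < t → fn lam h x t / t < deriv (fun s => fn lam h x s) t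
  /-- (C3): `F(x,t) ≤ M₁(g(x) + f(x,t))` with `0 ≤ g ∈ L¹(B, dv_g)`. -/
  F_bound : ∃ M₁ : ℝ, 0 < M₁ ∧ ∃ g : Pt → ℝ, (∀ x, 0 ≤ g x) ∧ HIntegrable g ∧
    ∀ x ∈ B, ∀ t : ℝ, 0 < t → Fn lam h x t ≤ M₁ * (g x + fn lam h x t)
  /-- (C4), first part: `inf_{x ∈ K} h(x,t) e^{εt²} → ∞` as `t → ∞`,
  for every compact `K ⊆ B`. -/
  h_inf : ∀ ε : ℝ, 0 < ε → ∀ K : Set Pt, K ⊆ B → IsCompact K →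
    ∀ c : ℝ, ∃ T : ℝ, ∀ t : ℝ, T ≤ t → ∀ x ∈ K, c ≤ h x t * Real.exp (ε * t ^ 2)
  /-- (C4), second part: `sup_{x ∈ B} h(x,t) e^{-εt²} → 0` as `t → ∞`. -/
  h_sup : ∀ ε : ℝ, 0 < ε → ∀ c : ℝ, 0 < c → ∃ T : ℝ, ∀ t : ℝ, T ≤ t → ∀ x ∈ B,
    h x t * Real.exp (-ε * t ^ 2) < c

/-- Condition (C5): there are `δ > 0` and `α₀ ∈ (0,1)` with
`|h(x,t)| ≤ C_N (1-|x|²)^δ` for `α₀ < |x| < 1` and `|t| ≤ N`. -/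
def CondC5 (h : Pt → ℝ → ℝ) : Prop :=
  ∃ δ : ℝ, 0 < δ ∧ ∃ α₀ : ℝ, α₀ ∈ Ioo (0 : ℝ) 1 ∧
    ∀ N : ℝ, 0 < N → ∃ C : ℝ, 0 < C ∧
      ∀ x : Pt, α₀ < ‖x‖ → ‖x‖ < 1 → ∀ t : ℝ, |t| ≤ N →
        |h x t| ≤ C * (1 - ‖x‖ ^ 2) ^ δ

/-- Condition (C6): for every `ε > 0` there are `α(ε) ∈ (0,1)`, `l > 0`, `t_ε > 0`
with `h(x,t) ≥ (1-|x|²)^l e^{-εt²}` for `α(ε) < |x| < 1` and `t ≥ t_ε`. -/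
def CondC6 (h : Pt → ℝ → ℝ) : Prop :=
  ∀ ε : ℝ, 0 < ε → ∃ α : ℝ, α ∈ Ioo (0 : ℝ) 1 ∧ ∃ l : ℝ, 0 < l ∧ ∃ tε : ℝ, 0 < tε ∧
    ∀ x : Pt, α < ‖x‖ → ‖x‖ < 1 → ∀ t : ℝ, tε ≤ t →
      (1 - ‖x‖ ^ 2) ^ l * Real.exp (-ε * t ^ 2) ≤ h x t

/-- The Euclidean divergence of a planar vector field. -/
def divergence (X : Pt → Pt) (y : Pt) : ℝ :=
  ∑ i, (fderiv ℝ X y (EuclideanSpace.single i 1)) i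

lemma isOpen_B : IsOpen B := Metric.isOpen_ball

lemma measurableSet_B : MeasurableSet B := isOpen_B.measurableSet

lemma mem_B_iff {y : Pt} : y ∈ B ↔ ‖y‖ < 1 := by simp [B]

lemma one_sub_sq_pos {y : Pt} (hy : y ∈ B) : 0 < 1 - ‖y‖ ^ 2 := by
  have := mem_B_iff.1 hy
  nlinarith [norm_nonneg y]

lemma inner_gradient_eq (w : Pt → ℝ) (y v : Pt) :
    inner ℝ (gradient w y) v = fderiv ℝ w y v := by
  simp [gradient]

lemma gradient_apply (w : Pt → ℝ) (y : Pt) (i : Fin 2) :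
    gradient w y i = fderiv ℝ w y (EuclideanSpace.single i 1) := by
  rw [← inner_gradient_eq, EuclideanSpace.inner_single_right]
  simp

lemma measurable_gradient (w : Pt → ℝ) : Measurable (gradient w) := by
  unfold gradient
  exact (LinearIsometryEquiv.continuous _).measurable.comp (measurable_fderiv ℝ w)

/-- Integration by parts on the disc against a compactly supported vector field. -/
lemma integral_inner_gradient_of_compactSupport {w : Pt → ℝ} {Z : Pt → Pt} {r : ℝ}
    (hr : r < 1) (hw : DifferentiableOn ℝ w B) (hgw : IntegrableOn (gradient w) B)
    (hZ : ContDiff ℝ 1 Z) (hsupp : ∀ y, r < ‖y‖ → Z y = 0) :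
    ∫ y in B, inner ℝ (gradient w y) (Z y) = -∫ y in B, w y * divergence Z y := by
  have hK : IsCompact (Metric.closedBall (0 : Pt) r) := isCompact_closedBall _ _
  have hKB : Metric.closedBall (0 : Pt) r ⊆ B := Metric.closedBall_subset_ball hr
  have htZ : tsupport Z ⊆ Metric.closedBall (0 : Pt) r := by
    refine closure_minimal (fun y hy => ?_) Metric.isClosed_closedBall
    by_contra hc
    exact hy (hsupp y (by simpa using hc))
  have hZc : HasCompactSupport Z := hK.of_isClosed_subset (isClosed_tsupport _) htZ
  have hdZ : ∀ y, y ∉ Metric.closedBall (0 : Pt) r → fderiv ℝ Z y = 0 := fun y hy =>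
    image_eq_zero_of_notMem_tsupport (fun hc => hy (htZ (tsupport_fderiv_subset ℝ hc)))
  have hwK : ContinuousOn w (Metric.closedBall (0 : Pt) r) := hw.continuousOn.mono hKB
  have hdZc : Continuous (fderiv ℝ Z) := hZ.continuous_fderiv (by simp)
  -- integrability of the three products, coordinatewise
  have hInteg : ∀ (φ : Pt → ℝ), Continuous φ → (∀ y, y ∉ Metric.closedBall (0 : Pt) r → φ y = 0) →
      Integrable (fun y => w y * φ y) := by
    intro φ hφ h0
    have h1 : IntegrableOn (fun y => w y * φ y) (Metric.closedBall (0 : Pt) r) :=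
      (hwK.mul hφ.continuousOn).integrableOn_compact hK
    refine (integrableOn_iff_integrable_of_support_subset (fun y hy => ?_)).1 h1
    by_contra hc
    exact hy (by simp [h0 y hc])
  have hi : ∀ i : Fin 2, (∫ y, gradient w y i * Z y i) =
        - ∫ y, w y * (fderiv ℝ Z y (EuclideanSpace.single i 1)) i ∧
      Integrable (fun y => gradient w y i * Z y i) ∧
      Integrable (fun y => w y * (fderiv ℝ Z y (EuclideanSpace.single i 1)) i) := by
    intro i
    have hZi : Continuous fun y => Z y i := by
      have := hZ.continuous
      fun_prop
    have hZ0 : ∀ y, y ∉ Metric.closedBall (0 : Pt) r → Z y i = 0 := fun y hy => by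
      rw [hsupp y (by simpa using hy)]; rfl
    have hwdZ : Integrable (fun y => w y * (fderiv ℝ Z y (EuclideanSpace.single i 1)) i) := by
      refine hInteg _ ?_ fun y hy => by rw [hdZ y hy]; rfl
      have : Continuous fun y => fderiv ℝ Z y (EuclideanSpace.single i 1) :=
        hdZc.clm_apply continuous_const
      fun_prop
    have hgZ : Integrable (fun y => gradient w y i * Z y i) := by
      have hgi : IntegrableOn (fun y => gradient w y i) B :=
        ((EuclideanSpace.proj i : Pt →L[ℝ] ℝ).integrable_comp hgw)
      obtain ⟨C, hC⟩ := (hZc.comp_left (g := fun z : Pt => z i) rfl).exists_bound_of_continuous hZi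
      have h1 : IntegrableOn (fun y => gradient w y i * Z y i) B :=
        Integrable.mul_bdd (c := C) hgi hZi.aestronglyMeasurable (ae_of_all _ fun y => hC y)
      refine (integrableOn_iff_integrable_of_support_subset (fun y hy => ?_)).1 h1
      by_contra hc
      exact hy (by simp [hZ0 y (fun h => hc (hKB h))])
    refine ⟨?_, hgZ, hwdZ⟩
    have key := integral_bilinear_hasLineDerivAt_right_eq_neg_left_of_integrable
      (μ := (volume : Measure Pt)) (f := w) (f' := fun y => gradient w y i)
      (g := fun y => Z y i) (g' := fun y => (fderiv ℝ Z y (EuclideanSpace.single i 1)) i)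
      (v := EuclideanSpace.single i 1) (B := ContinuousLinearMap.mul ℝ ℝ)
      (by simpa using hgZ) (by simpa using hwdZ) (by simpa using hInteg _ hZi hZ0) ?_ ?_
    · simp only [ContinuousLinearMap.mul_apply'] at key
      linarith
    · intro y hy
      have hyB : y ∈ B := by
        apply hKB
        refine closure_minimal (fun z hz => ?_) Metric.isClosed_closedBall hy
        by_contra hc
        exact hz (hZ0 z hc)
      have := ((hw y hyB).differentiableAt (isOpen_B.mem_nhds hyB)).hasFDerivAt.hasLineDerivAt
        (EuclideanSpace.single i 1)
      rwa [← gradient_apply] at this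
    · intro y _
      have h1 : HasFDerivAt Z (fderiv ℝ Z y) y :=
        (hZ.differentiable (by simp) y).hasFDerivAt
      exact ((EuclideanSpace.proj i : Pt →L[ℝ] ℝ).hasFDerivAt.comp y h1).hasLineDerivAt
        (EuclideanSpace.single i 1)
  have e1 : ∫ y in B, inner ℝ (gradient w y) (Z y) = ∫ y, inner ℝ (gradient w y) (Z y) := by
    refine setIntegral_eq_integral_of_forall_compl_eq_zero fun y hy => ?_
    rw [hsupp y (lt_of_lt_of_le hr (not_lt.1 fun h => hy (mem_B_iff.2 h)))]
    simp
  have e2 : ∫ y in B, w y * divergence Z y = ∫ y, w y * divergence Z y := by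
    refine setIntegral_eq_integral_of_forall_compl_eq_zero fun y hy => ?_
    rw [divergence, hdZ y (fun h => hy (hKB h))]
    simp
  rw [e1, e2]
  have e3 : ∀ y, inner ℝ (gradient w y) (Z y) = gradient w y 0 * Z y 0 + gradient w y 1 * Z y 1 := by
    intro y
    rw [PiLp.inner_apply, Fin.sum_univ_two]
    simp [mul_comm]
  simp_rw [e3, divergence, Fin.sum_univ_two, mul_add]
  rw [integral_add (hi 0).2.1 (hi 1).2.1, integral_add (hi 0).2.2 (hi 1).2.2, (hi 0).1, (hi 1).1]
  ring

/-- A smooth cutoff of the disc, with support in `n * (1 - |y|²) ≥ 1`. -/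
def discCutoff (n : ℕ) (y : Pt) : ℝ := smoothTransition (n * (1 - ‖y‖ ^ 2) - 1)

lemma exists_abs_deriv_smoothTransition_le :
    ∃ K, ∀ t : ℝ, |deriv smoothTransition t| ≤ K ∧
      (t ∉ Icc (0 : ℝ) 1 → deriv smoothTransition t = 0) := by
  have hc : Continuous (deriv smoothTransition) :=
    (smoothTransition.contDiff (n := 1)).continuous_deriv (by simp)
  obtain ⟨K, hK⟩ := isCompact_Icc.exists_bound_of_continuousOn (s := Icc (0 : ℝ) 1) hc.continuousOn
  have h0 : ∀ t : ℝ, t ∉ Icc (0 : ℝ) 1 → deriv smoothTransition t = 0 := by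
    intro t ht
    rcases lt_or_ge t 0 with h | h
    · have : smoothTransition =ᶠ[nhds t] fun _ => 0 := by
        filter_upwards [Iio_mem_nhds h] with z hz using smoothTransition.zero_of_nonpos (le_of_lt hz)
      rw [this.deriv_eq]; simp
    · have h1 : 1 < t := by
        by_contra hc
        exact ht ⟨h, not_lt.1 hc⟩
      have : smoothTransition =ᶠ[nhds t] fun _ => 1 := by
        filter_upwards [Ioi_mem_nhds h1] with z hz using smoothTransition.one_of_one_le (le_of_lt hz)
      rw [this.deriv_eq]; simp
  refine ⟨max K 0, fun t => ⟨?_, h0 t⟩⟩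
  by_cases ht : t ∈ Icc (0 : ℝ) 1
  · exact (hK t ht).trans (le_max_left _ _)
  · rw [h0 t ht]; simp

lemma contDiff_discCutoff (n : ℕ) : ContDiff ℝ 1 (discCutoff n) := by
  unfold discCutoff
  exact smoothTransition.contDiff.comp
    ((contDiff_const.mul (contDiff_const.sub (contDiff_norm_sq ℝ))).sub contDiff_const)

lemma hasFDerivAt_discCutoff (n : ℕ) (y : Pt) :
    HasFDerivAt (discCutoff n)
      ((-2 * n * deriv smoothTransition (n * (1 - ‖y‖ ^ 2) - 1)) • innerSL ℝ y) y := by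
  have h1 : HasFDerivAt (fun z : Pt => (n : ℝ) * (1 - ‖z‖ ^ 2) - 1)
      ((n : ℝ) • (-((2 : ℝ) • innerSL ℝ y))) y := by
    have h : HasFDerivAt (fun z : Pt => ‖z‖ ^ 2) ((2 : ℝ) • innerSL ℝ y) y :=
      (hasStrictFDerivAt_norm_sq y).hasFDerivAt.congr_fderiv (by ext v; simp [two_smul])
    exact ((h.const_sub 1).const_mul (n : ℝ)).sub_const 1
  have h2 : HasDerivAt smoothTransition (deriv smoothTransition (n * (1 - ‖y‖ ^ 2) - 1))
      (n * (1 - ‖y‖ ^ 2) - 1) :=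
    ((smoothTransition.contDiff (n := 1)).differentiable (by simp) _).hasDerivAt
  refine (h2.comp_hasFDerivAt y h1).congr_fderiv ?_
  ext v
  simp
  ring

/-- Integration by parts on the disc when the boundary terms vanish. -/
theorem integral_inner_gradient {w : Pt → ℝ} {X : Pt → Pt}
    (hw : DifferentiableOn ℝ w B) (hgw : IntegrableOn (gradient w) B)
    (hX : ContDiffOn ℝ 1 X B)
    (h1 : IntegrableOn (fun y => inner ℝ (gradient w y) (X y)) B)
    (h2 : IntegrableOn (fun y => w y * divergence X y) B)
    (h3 : IntegrableOn (fun y => |w y| * ‖X y‖ / (1 - ‖y‖ ^ 2)) B) :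
    ∫ y in B, inner ℝ (gradient w y) (X y) = -∫ y in B, w y * divergence X y := by
  obtain ⟨K, hK⟩ := exists_abs_deriv_smoothTransition_le
  set d : ℕ → Pt → ℝ := fun n y => -2 * n * deriv smoothTransition (n * (1 - ‖y‖ ^ 2) - 1)
    with hd
  have hKnn : 0 ≤ K := (abs_nonneg _).trans (hK 0).1
  have hXd : ∀ y ∈ B, HasFDerivAt X (fderiv ℝ X y) y := fun y hy =>
    ((hX.differentiableOn (by simp) y hy).differentiableAt (isOpen_B.mem_nhds hy)).hasFDerivAt
  have hstep : ∀ n : ℕ, ∫ y in B, discCutoff n y * inner ℝ (gradient w y) (X y) =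
      -∫ y in B, (discCutoff n y * (w y * divergence X y) + w y * (d n y * inner ℝ y (X y))) := by
    intro n
    -- the support radius of the cutoff
    obtain ⟨r, hr1, hr⟩ : ∃ r : ℝ, r < 1 ∧ ∀ y : Pt, r < ‖y‖ → discCutoff n y = 0 := by
      refine ⟨√(1 - 1 / (n + 1)), ?_, fun y hy => ?_⟩
      · rw [Real.sqrt_lt' one_pos]
        have : (0 : ℝ) < 1 / (n + 1) := by positivity
        linarith
      · apply smoothTransition.zero_of_nonpos
        have h4 : 1 - 1 / ((n : ℝ) + 1) < ‖y‖ ^ 2 := by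
          have := Real.lt_sq_of_sqrt_lt hy
          linarith
        have h5 : (n : ℝ) * (1 - ‖y‖ ^ 2) ≤ n * (1 / (n + 1)) := by
          gcongr; linarith
        have h6 : (n : ℝ) * (1 / (n + 1)) ≤ 1 := by
          rw [mul_one_div, div_le_one (by positivity)]; linarith
        linarith
    have hZ : ContDiff ℝ 1 (fun y => discCutoff n y • X y) := by
      rw [contDiff_iff_contDiffAt]
      intro y
      by_cases hy : y ∈ B
      · exact (contDiff_discCutoff n).contDiffAt.smul (hX.contDiffAt (isOpen_B.mem_nhds hy))
      · have hy' : r < ‖y‖ := lt_of_lt_of_le hr1 (not_lt.1 fun h => hy (mem_B_iff.2 h))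
        have : (fun y => discCutoff n y • X y) =ᶠ[nhds y] fun _ => 0 := by
          filter_upwards [(isOpen_lt continuous_const continuous_norm).mem_nhds hy'] with z hz
          rw [hr z hz, zero_smul]
        exact contDiffAt_const.congr_of_eventuallyEq this
    have := integral_inner_gradient_of_compactSupport hr1 hw hgw hZ
      (fun y hy => by rw [hr y hy, zero_smul])
    simp only [inner_smul_right] at this
    rw [this]
    congr 1
    refine setIntegral_congr_fun measurableSet_B fun y hy => ?_
    have hdv : HasFDerivAt (fun y => discCutoff n y • X y) _ y :=
      (hasFDerivAt_discCutoff n y).smul (hXd y hy)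
    simp only [divergence, hdv.fderiv]
    simp [Fin.sum_univ_two, PiLp.inner_apply, hd]
    ring
  have hcut_le : ∀ n y, |discCutoff n y| ≤ 1 := fun n y => by
    rw [discCutoff, abs_of_nonneg (smoothTransition.nonneg _)]; exact smoothTransition.le_one _
  have hlim : ∀ y ∈ B, ∀ᶠ n : ℕ in atTop, discCutoff n y = 1 ∧ d n y = 0 := by
    intro y hy
    have hp := one_sub_sq_pos hy
    have ht : Tendsto (fun n : ℕ => (n : ℝ) * (1 - ‖y‖ ^ 2)) atTop atTop :=
      tendsto_natCast_atTop_atTop.atTop_mul_const hp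
    filter_upwards [ht.eventually_gt_atTop 2] with n hn
    refine ⟨smoothTransition.one_of_one_le (by linarith), ?_⟩
    simp only [hd]
    rw [(hK _).2 (fun h => by linarith [h.2]), mul_zero]
  have hcm : ∀ n, Continuous (discCutoff n) := fun n => (contDiff_discCutoff n).continuous
  have hdm : ∀ n, Continuous (d n) := fun n => by
    have : Continuous (deriv smoothTransition) :=
      (smoothTransition.contDiff (n := 1)).continuous_deriv (by simp)
    simp only [hd]
    fun_prop
  have hwm : AEStronglyMeasurable w (volume.restrict B) :=
    hw.continuousOn.aestronglyMeasurable measurableSet_B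
  have hXm : AEStronglyMeasurable X (volume.restrict B) :=
    hX.continuousOn.aestronglyMeasurable measurableSet_B
  have L1 : Tendsto (fun n => ∫ y in B, discCutoff n y * inner ℝ (gradient w y) (X y)) atTop
      (nhds (∫ y in B, inner ℝ (gradient w y) (X y))) := by
    refine tendsto_integral_of_dominated_convergence _
      (fun n => (hcm n).aestronglyMeasurable.mul h1.1) h1.norm
      (fun n => ae_of_all _ fun y => ?_) ?_
    · rw [norm_mul]
      exact mul_le_of_le_one_left (norm_nonneg _) (hcut_le n y)
    · filter_upwards [ae_restrict_mem measurableSet_B] with y hy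
      refine tendsto_const_nhds.congr' ?_
      filter_upwards [hlim y hy] with n hn
      rw [hn.1, one_mul]
  have L2 : Tendsto (fun n => ∫ y in B, (discCutoff n y * (w y * divergence X y) +
      w y * (d n y * inner ℝ y (X y)))) atTop
      (nhds (∫ y in B, w y * divergence X y)) := by
    refine tendsto_integral_of_dominated_convergence
      (fun y => ‖w y * divergence X y‖ + 4 * K * (|w y| * ‖X y‖ / (1 - ‖y‖ ^ 2)))
      (fun n => ((hcm n).aestronglyMeasurable.mul h2.1).add
        (hwm.mul ((hdm n).aestronglyMeasurable.mul
          (continuous_id.aestronglyMeasurable.inner hXm)))) (h2.norm.add (h3.const_mul _))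
      (fun n => ?_) ?_
    · filter_upwards [ae_restrict_mem measurableSet_B] with y hy
      have hp := one_sub_sq_pos hy
      refine (norm_add_le _ _).trans (add_le_add ?_ ?_)
      · rw [norm_mul]
        exact mul_le_of_le_one_left (norm_nonneg _) (hcut_le n y)
      · have hdn : |d n y| ≤ 4 * K / (1 - ‖y‖ ^ 2) := by
          by_cases ht : (n * (1 - ‖y‖ ^ 2) - 1) ∈ Icc (0 : ℝ) 1
          · have h7 : (n : ℝ) ≤ 2 / (1 - ‖y‖ ^ 2) := by
              rw [le_div_iff₀ hp]; linarith [ht.2]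
            simp only [hd, abs_mul]
            rw [abs_neg, abs_of_pos (by norm_num : (0 : ℝ) < 2), abs_of_nonneg n.cast_nonneg]
            calc _ ≤ 2 * (2 / (1 - ‖y‖ ^ 2)) * K := by
                  gcongr; exact (hK _).1
              _ = _ := by ring
          · simp only [hd]
            rw [(hK _).2 ht]
            simp only [mul_zero, abs_zero]
            positivity
        have hin : |inner ℝ y (X y)| ≤ ‖X y‖ := by
          refine (abs_real_inner_le_norm _ _).trans ?_
          exact mul_le_of_le_one_left (norm_nonneg _) (mem_B_iff.1 hy).le
        rw [Real.norm_eq_abs, abs_mul, abs_mul]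
        calc |w y| * (|d n y| * |inner ℝ y (X y)|)
            ≤ |w y| * (4 * K / (1 - ‖y‖ ^ 2) * ‖X y‖) := by gcongr
          _ = _ := by ring
    · filter_upwards [ae_restrict_mem measurableSet_B] with y hy
      refine tendsto_const_nhds.congr' ?_
      filter_upwards [hlim y hy] with n hn
      rw [hn.1, hn.2]; ring
  exact tendsto_nhds_unique L1 (L2.neg.congr fun n => (hstep n).symm)

lemma dens_nonneg (y : Pt) : 0 ≤ dens y := sq_nonneg _

lemma measurable_dens : Measurable dens := by
  unfold dens
  fun_prop

lemma four_le_dens {y : Pt} (hy : y ∈ B) : 4 ≤ dens y := by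
  have h := one_sub_sq_pos hy
  have : 2 ≤ 2 / (1 - ‖y‖ ^ 2) := by
    rw [le_div_iff₀ h]; nlinarith [sq_nonneg ‖y‖]
  unfold dens; nlinarith

instance : IsFiniteMeasure (volume.restrict B) :=
  ⟨by rw [Measure.restrict_apply_univ]; exact Metric.isBounded_ball.measure_lt_top⟩

lemma IsH1.aestronglyMeasurable {u : Pt → ℝ} (hu : IsH1 u) :
    AEStronglyMeasurable u (volume.restrict B) :=
  hu.1.continuousOn.aestronglyMeasurable measurableSet_B

lemma IsH1.hasFDerivAt {u : Pt → ℝ} (hu : IsH1 u) {y : Pt} (hy : y ∈ B) :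
    HasFDerivAt u (fderiv ℝ u y) y :=
  ((hu.1 y hy).differentiableAt (isOpen_B.mem_nhds hy)).hasFDerivAt

lemma IsH1.integrable_gradient {u : Pt → ℝ} (hu : IsH1 u) : IntegrableOn (gradient u) B := by
  refine Integrable.mono' ((integrable_const (1 : ℝ)).add hu.2.1)
    (measurable_gradient u).aestronglyMeasurable (ae_of_all _ fun y => ?_)
  simp only [Pi.add_apply]
  nlinarith [sq_nonneg (‖gradient u y‖ - 1)]

/-- The sharp Hardy (hyperbolic Poincaré) inequality on the disc. -/
theorem IsH1.hardy {u : Pt → ℝ} (hu : IsH1 u) : hInt (fun x => (u x) ^ 2) ≤ 4 * enormSq u := by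
  set X : Pt → Pt := fun y => (2 / (1 - ‖y‖ ^ 2)) • y with hXdef
  have hXd : ∀ y ∈ B, HasFDerivAt X ((2 / (1 - ‖y‖ ^ 2)) • ContinuousLinearMap.id ℝ Pt +
      ((4 / (1 - ‖y‖ ^ 2) ^ 2) • innerSL ℝ y).smulRight y) y := by
    intro y hy
    have hp := one_sub_sq_pos hy
    have h : HasFDerivAt (fun z : Pt => ‖z‖ ^ 2) ((2 : ℝ) • innerSL ℝ y) y :=
      (hasStrictFDerivAt_norm_sq y).hasFDerivAt.congr_fderiv (by ext v; simp [two_smul])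
    have h1 : HasFDerivAt (fun z : Pt => 2 / (1 - ‖z‖ ^ 2)) ((4 / (1 - ‖y‖ ^ 2) ^ 2) • innerSL ℝ y) y := by
      have h2 : HasDerivAt (fun t : ℝ => 2 / (1 - t)) (2 / (1 - ‖y‖ ^ 2) ^ 2) (‖y‖ ^ 2) := by
        have := (((hasDerivAt_id (‖y‖ ^ 2)).const_sub 1).fun_inv hp.ne').const_mul 2
        simpa [div_eq_mul_inv] using this
      refine (h2.comp_hasFDerivAt y h).congr_fderiv ?_
      ext v; simp; ring
    exact h1.smul (hasFDerivAt_id y)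
  have hXc : ContDiffOn ℝ 1 X B := by
    refine (ContDiffOn.div contDiffOn_const (contDiffOn_const.sub (contDiff_norm_sq ℝ).contDiffOn)
      fun y hy => (one_sub_sq_pos hy).ne').smul contDiffOn_id
  have hdiv : ∀ y ∈ B, divergence X y = dens y := by
    intro y hy
    have hp := one_sub_sq_pos hy
    have hn : ‖y‖ ^ 2 = y 0 ^ 2 + y 1 ^ 2 := by
      rw [EuclideanSpace.norm_sq_eq]; simp [Fin.sum_univ_two]
    simp only [divergence, (hXd y hy).fderiv, dens]
    simp [Fin.sum_univ_two, PiLp.inner_apply]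
    field_simp
    rw [hn]; ring
  have hXn : ∀ y ∈ B, ‖X y‖ ^ 2 ≤ dens y := by
    intro y hy
    have hp := one_sub_sq_pos hy
    simp only [hXdef, norm_smul, mul_pow, dens, Real.norm_eq_abs, sq_abs]
    refine mul_le_of_le_one_right (by positivity) (by linarith)
  have hXn' : ∀ y ∈ B, ‖X y‖ / (1 - ‖y‖ ^ 2) ≤ dens y := by
    intro y hy
    have hp := one_sub_sq_pos hy
    have h1 := (mem_B_iff.1 hy).le
    simp only [hXdef, norm_smul, dens, Real.norm_eq_abs]
    rw [abs_of_pos (by positivity), div_le_iff₀ hp, div_pow]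
    field_simp
    linarith
  have hgrad : ∀ y ∈ B, gradient (fun z => u z ^ 2) y = (2 * u y) • gradient u y := by
    intro y hy
    have h := (hu.hasFDerivAt hy).pow 2
    simp only [gradient]
    rw [h.fderiv]
    simp
  have hI := hu.2.2
  unfold HIntegrable at hI
  have hw : DifferentiableOn ℝ (fun z => u z ^ 2) B := hu.1.pow 2
  have hdom : IntegrableOn (fun y => u y ^ 2 * dens y + ‖gradient u y‖ ^ 2) B := hI.add hu.2.1
  have hXm : AEStronglyMeasurable X (volume.restrict B) :=
    hXc.continuousOn.aestronglyMeasurable measurableSet_B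
  have hin : ∀ y ∈ B, inner ℝ (gradient (fun z => u z ^ 2) y) (X y) =
      2 * u y * inner ℝ (gradient u y) (X y) := by
    intro y hy
    rw [hgrad y hy, real_inner_smul_left]
  have hbd : ∀ y ∈ B, |2 * u y * inner ℝ (gradient u y) (X y)| ≤
      1 / 2 * (u y ^ 2 * dens y) + 2 * ‖gradient u y‖ ^ 2 := by
    intro y hy
    have h1 := abs_real_inner_le_norm (gradient u y) (X y)
    have h2 : u y ^ 2 * ‖X y‖ ^ 2 ≤ u y ^ 2 * dens y :=
      mul_le_mul_of_nonneg_left (hXn y hy) (sq_nonneg _)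
    have h3 : |2 * u y * inner ℝ (gradient u y) (X y)| ≤ 2 * (|u y| * ‖X y‖) * ‖gradient u y‖ := by
      rw [abs_mul, abs_mul, abs_two]
      calc _ ≤ 2 * |u y| * (‖gradient u y‖ * ‖X y‖) := by gcongr
        _ = _ := by ring
    have h4 : (|u y| * ‖X y‖) ^ 2 = u y ^ 2 * ‖X y‖ ^ 2 := by rw [mul_pow, sq_abs]
    nlinarith [sq_nonneg (|u y| * ‖X y‖ - 2 * ‖gradient u y‖)]
  have key := integral_inner_gradient (w := fun z => u z ^ 2) (X := X) hw ?_ hXc ?_ ?_ ?_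
  · rw [setIntegral_congr_fun measurableSet_B hin,
      setIntegral_congr_fun (f := fun y => u y ^ 2 * divergence X y)
        (g := fun y => u y ^ 2 * dens y) measurableSet_B
        (fun y hy => by simp only [hdiv y hy])] at key
    have h5 : -∫ y in B, (1 / 2 * (u y ^ 2 * dens y) + 2 * ‖gradient u y‖ ^ 2) ≤
        ∫ y in B, 2 * u y * inner ℝ (gradient u y) (X y) := by
      rw [← integral_neg]
      refine setIntegral_mono_on ((hI.const_mul _).add (hu.2.1.const_mul _)).neg ?_ measurableSet_B
        fun y hy => (abs_le.1 (hbd y hy)).1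
      refine Integrable.mono' ((hI.const_mul (1 / 2)).add (hu.2.1.const_mul 2)) ?_ ?_
      · exact (hu.aestronglyMeasurable.const_mul 2).mul
          ((measurable_gradient u).aestronglyMeasurable.inner hXm)
      · filter_upwards [ae_restrict_mem measurableSet_B] with y hy using hbd y hy
    rw [integral_add (hI.const_mul _) (hu.2.1.const_mul _), integral_const_mul,
      integral_const_mul, key] at h5
    unfold hInt enormSq
    linarith
  · refine Integrable.mono' hdom (measurable_gradient _).aestronglyMeasurable ?_
    filter_upwards [ae_restrict_mem measurableSet_B] with y hy
    rw [hgrad y hy, norm_smul, Real.norm_eq_abs, abs_mul, abs_two]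
    have := four_le_dens hy
    nlinarith [sq_nonneg (|u y| - ‖gradient u y‖), sq_abs (u y), sq_nonneg (u y)]
  · refine Integrable.mono' ((hI.const_mul (1 / 2)).add (hu.2.1.const_mul 2)) ?_ ?_
    · exact (measurable_gradient _).aestronglyMeasurable.inner hXm
    · filter_upwards [ae_restrict_mem measurableSet_B] with y hy
      rw [hin y hy]
      exact hbd y hy
  · refine hI.congr_fun (fun y hy => ?_) measurableSet_B
    simp only [hdiv y hy]
  · refine Integrable.mono' hI ?_ ?_
    · refine ((hw.continuousOn.abs.mul hXc.continuousOn.norm).div (by fun_prop)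
        fun y hy => (one_sub_sq_pos hy).ne').aestronglyMeasurable measurableSet_B
    · filter_upwards [ae_restrict_mem measurableSet_B] with y hy
      have hp := one_sub_sq_pos hy
      rw [Real.norm_eq_abs, abs_of_nonneg (by positivity), abs_of_nonneg (sq_nonneg _), mul_div_assoc]
      exact mul_le_mul_of_nonneg_left (hXn' y hy) (sq_nonneg _)

/-- The quadratic polynomial `a|y|² - 2⟨x,y⟩ + b`. -/
def planeQuad (a b : ℝ) (x y : Pt) : ℝ := a * ‖y‖ ^ 2 - 2 * inner ℝ x y + b

/-- The gradient of `log (planeQuad a b x + s)`. -/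
def logQuadField (s a b : ℝ) (x y : Pt) : Pt :=
  (planeQuad a b x y + s)⁻¹ • ((2 * a) • y - (2 : ℝ) • x)

lemma hasFDerivAt_planeQuad (a b : ℝ) (x y : Pt) :
    HasFDerivAt (planeQuad a b x) (innerSL ℝ ((2 * a) • y - (2 : ℝ) • x)) y := by
  have h : HasFDerivAt (fun z : Pt => ‖z‖ ^ 2) ((2 : ℝ) • innerSL ℝ y) y :=
    (hasStrictFDerivAt_norm_sq y).hasFDerivAt.congr_fderiv (by ext v; simp [two_smul])
  have h1 : HasFDerivAt (fun z : Pt => inner ℝ x z) (innerSL ℝ x) y := (innerSL ℝ x).hasFDerivAt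
  refine (((h.const_mul a).sub (h1.const_mul 2)).add_const b).congr_fderiv ?_
  ext v
  simp
  ring

lemma hasFDerivAt_log_planeQuad {s a b : ℝ} {x y : Pt} (hp : 0 < planeQuad a b x y + s) :
    HasFDerivAt (fun z => Real.log (planeQuad a b x z + s)) (innerSL ℝ (logQuadField s a b x y)) y := by
  refine (((hasFDerivAt_planeQuad a b x y).add_const s).log hp.ne').congr_fderiv ?_
  simp [logQuadField]

lemma hasFDerivAt_logQuadField {s a b : ℝ} {x y : Pt} (hp : 0 < planeQuad a b x y + s) :
    HasFDerivAt (logQuadField s a b x)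
      ((planeQuad a b x y + s)⁻¹ • ((2 * a) • ContinuousLinearMap.id ℝ Pt) +
        (-((planeQuad a b x y + s) ^ 2)⁻¹ • innerSL ℝ ((2 * a) • y - (2 : ℝ) • x)).smulRight
          ((2 * a) • y - (2 : ℝ) • x)) y := by
  have h1 := (hasDerivAt_inv hp.ne').comp_hasFDerivAt y
    ((hasFDerivAt_planeQuad a b x y).add_const s)
  have h2 : HasFDerivAt (fun z : Pt => (2 * a) • z - (2 : ℝ) • x)
      ((2 * a) • ContinuousLinearMap.id ℝ Pt) y :=
    ((hasFDerivAt_id y).const_smul (2 * a)).sub_const _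
  exact h1.smul h2

lemma hasDivergence_logQuadField {s a b : ℝ} {x y : Pt} (hab : a * b = ‖x‖ ^ 2)
    (hp : 0 < planeQuad a b x y + s) :
    ∃ L : Pt →L[ℝ] Pt, HasFDerivAt (logQuadField s a b x) L y ∧
      ∑ i, (L (EuclideanSpace.single i 1)) i = 4 * a * s / (planeQuad a b x y + s) ^ 2 := by
  refine ⟨_, hasFDerivAt_logQuadField hp, ?_⟩
  set Q := planeQuad a b x y + s with hQ
  have hn : ∀ z : Pt, ‖z‖ ^ 2 = z 0 ^ 2 + z 1 ^ 2 := fun z => by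
    rw [EuclideanSpace.norm_sq_eq]; simp [Fin.sum_univ_two]
  have hQ' : Q = a * (y 0 ^ 2 + y 1 ^ 2) - 2 * (x 0 * y 0 + x 1 * y 1) + b + s := by
    rw [hQ, planeQuad, hn, PiLp.inner_apply]
    simp [Fin.sum_univ_two]; ring
  rw [hn] at hab
  simp [Fin.sum_univ_two, PiLp.inner_apply]
  field_simp
  rw [hQ']
  linear_combination 4 * hab

/-- `|1 - x̄y|²` in complex notation. -/
abbrev imageQuad (x y : Pt) : ℝ := planeQuad (‖x‖ ^ 2) 1 x y

/-- `|x - y|²`. -/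
abbrev distQuad (x y : Pt) : ℝ := planeQuad 1 (‖x‖ ^ 2) x y

lemma distQuad_eq (x y : Pt) : distQuad x y = ‖x - y‖ ^ 2 := by
  rw [distQuad, planeQuad, norm_sub_sq_real]; ring

lemma distQuad_nonneg (x y : Pt) : 0 ≤ distQuad x y := by rw [distQuad_eq]; positivity

lemma imageQuad_nonneg (x y : Pt) : 0 ≤ imageQuad x y := by
  have := real_inner_le_norm x y
  unfold imageQuad planeQuad
  nlinarith [sq_nonneg (‖x‖ * ‖y‖ - 1)]

lemma imageQuad_sub_distQuad (x y : Pt) :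
    imageQuad x y - distQuad x y = (1 - ‖x‖ ^ 2) * (1 - ‖y‖ ^ 2) := by
  unfold imageQuad distQuad planeQuad; ring

lemma distQuad_le_imageQuad {x y : Pt} (hx : x ∈ B) (hy : y ∈ B) :
    distQuad x y ≤ imageQuad x y := by
  have := imageQuad_sub_distQuad x y
  nlinarith [mul_pos (one_sub_sq_pos hx) (one_sub_sq_pos hy)]

/-- The regularised Green function of the disc (times `4π`). -/
def green (s : ℝ) (x y : Pt) : ℝ := Real.log (imageQuad x y + s) - Real.log (distQuad x y + s)

/-- The gradient of `green s x`. -/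
def greenField (s : ℝ) (x y : Pt) : Pt :=
  logQuadField s (‖x‖ ^ 2) 1 x y - logQuadField s 1 (‖x‖ ^ 2) x y

/-- The negative Laplacian of `green s x`. -/
def greenMass (s : ℝ) (x y : Pt) : ℝ :=
  4 * s / (distQuad x y + s) ^ 2 - 4 * ‖x‖ ^ 2 * s / (imageQuad x y + s) ^ 2

section
variable {s : ℝ}

lemma gradient_green (hs : 0 < s) (x y : Pt) :
    HasFDerivAt (green s x) (innerSL ℝ (greenField s x y)) y := by
  refine ((hasFDerivAt_log_planeQuad (by linarith [imageQuad_nonneg x y])).sub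
    (hasFDerivAt_log_planeQuad (by linarith [distQuad_nonneg x y]))).congr_fderiv ?_
  simp [greenField]

lemma gradient_green_eq (hs : 0 < s) (x y : Pt) : gradient (green s x) y = greenField s x y := by
  rw [gradient, (gradient_green hs x y).fderiv]
  exact (InnerProductSpace.toDual ℝ Pt).symm_apply_apply _

lemma divergence_greenField (hs : 0 < s) (x y : Pt) :
    divergence (greenField s x) y = -greenMass s x y := by
  obtain ⟨L1, h1, e1⟩ := hasDivergence_logQuadField (s := s) (a := ‖x‖ ^ 2) (b := 1) (x := x) (y := y)
    (by ring) (by linarith [imageQuad_nonneg x y])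
  obtain ⟨L2, h2, e2⟩ := hasDivergence_logQuadField (s := s) (a := 1) (b := ‖x‖ ^ 2) (x := x) (y := y)
    (by ring) (by linarith [distQuad_nonneg x y])
  have h : HasFDerivAt (greenField s x) (L1 - L2) y := h1.sub h2
  rw [divergence, h.fderiv, greenMass]
  simp only [_root_.sub_apply, PiLp.sub_apply, Finset.sum_sub_distrib, e1, e2]
  ring

lemma continuous_planeQuad {a b : Pt → ℝ} (ha : Continuous a) (hb : Continuous b) :
    Continuous fun p : Pt × Pt => planeQuad (a p.1) (b p.1) p.1 p.2 := by
  unfold planeQuad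
  fun_prop

lemma continuous_imageQuad : Continuous fun p : Pt × Pt => imageQuad p.1 p.2 :=
  continuous_planeQuad (a := fun x => ‖x‖ ^ 2) (b := fun _ => 1) (by fun_prop) continuous_const

lemma continuous_distQuad : Continuous fun p : Pt × Pt => distQuad p.1 p.2 :=
  continuous_planeQuad (a := fun _ => 1) (b := fun x => ‖x‖ ^ 2) continuous_const (by fun_prop)

lemma continuous_green (hs : 0 < s) : Continuous fun p : Pt × Pt => green s p.1 p.2 := by
  unfold green
  refine Continuous.sub ?_ ?_
  · exact (continuous_imageQuad.add continuous_const).log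
      fun p => (add_pos_of_nonneg_of_pos (imageQuad_nonneg p.1 p.2) hs).ne'
  · exact (continuous_distQuad.add continuous_const).log
      fun p => (add_pos_of_nonneg_of_pos (distQuad_nonneg p.1 p.2) hs).ne'

lemma continuous_greenField (hs : 0 < s) : Continuous fun p : Pt × Pt => greenField s p.1 p.2 := by
  have h1 : Continuous fun p : Pt × Pt => (imageQuad p.1 p.2 + s)⁻¹ :=
    (continuous_imageQuad.add continuous_const).inv₀
      fun p => (add_pos_of_nonneg_of_pos (imageQuad_nonneg p.1 p.2) hs).ne'
  have h2 : Continuous fun p : Pt × Pt => (distQuad p.1 p.2 + s)⁻¹ :=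
    (continuous_distQuad.add continuous_const).inv₀
      fun p => (add_pos_of_nonneg_of_pos (distQuad_nonneg p.1 p.2) hs).ne'
  have h3 : Continuous fun p : Pt × Pt => (2 * ‖p.1‖ ^ 2) • p.2 - (2 : ℝ) • p.1 := by fun_prop
  have h4 : Continuous fun p : Pt × Pt => ((2 : ℝ) * 1) • p.2 - (2 : ℝ) • p.1 := by fun_prop
  exact (h1.smul h3).sub (h2.smul h4)

lemma continuous_greenMass (hs : 0 < s) : Continuous fun p : Pt × Pt => greenMass s p.1 p.2 := by
  have h1 : Continuous fun p : Pt × Pt => 4 * s / (distQuad p.1 p.2 + s) ^ 2 :=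
    continuous_const.div ((continuous_distQuad.add continuous_const).pow 2)
      fun p => (pow_pos (add_pos_of_nonneg_of_pos (distQuad_nonneg p.1 p.2) hs) 2).ne'
  have h2 : Continuous fun p : Pt × Pt => 4 * ‖p.1‖ ^ 2 * s / (imageQuad p.1 p.2 + s) ^ 2 :=
    Continuous.div (by fun_prop) ((continuous_imageQuad.add continuous_const).pow 2)
      fun p => (pow_pos (add_pos_of_nonneg_of_pos (imageQuad_nonneg p.1 p.2) hs) 2).ne'
  exact h1.sub h2

lemma contDiff_logQuadField {s a b : ℝ} {x : Pt} (h : ∀ y, 0 < planeQuad a b x y + s) :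
    ContDiff ℝ 1 (logQuadField s a b x) := by
  have h1 : ContDiff ℝ 1 fun y => planeQuad a b x y + s := by
    have hn : ContDiff ℝ 1 fun y : Pt => ‖y‖ ^ 2 := contDiff_norm_sq ℝ
    have hi : ContDiff ℝ 1 fun y : Pt => (inner ℝ x y : ℝ) := contDiff_const.inner ℝ contDiff_id
    exact (((contDiff_const.mul hn).sub (contDiff_const.mul hi)).add contDiff_const).add
      contDiff_const
  have h2 : ContDiff ℝ 1 fun y : Pt => (2 * a) • y - (2 : ℝ) • x :=
    (contDiff_id.const_smul (2 * a)).sub contDiff_const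
  exact (h1.inv fun y => (h y).ne').smul h2

lemma contDiff_greenField (hs : 0 < s) (x : Pt) : ContDiff ℝ 1 (greenField s x) :=
  (contDiff_logQuadField fun y => by linarith [imageQuad_nonneg x y]).sub
    (contDiff_logQuadField fun y => by linarith [distQuad_nonneg x y])

lemma continuous_green_right (hs : 0 < s) (x : Pt) : Continuous (green s x) :=
  Continuous.comp (g := fun p : Pt × Pt => green s p.1 p.2) (f := fun y => (x, y))
    (continuous_green hs) (by fun_prop)

lemma continuous_greenMass_right (hs : 0 < s) (x : Pt) : Continuous (greenMass s x) :=
  Continuous.comp (g := fun p : Pt × Pt => greenMass s p.1 p.2) (f := fun y => (x, y))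
    (continuous_greenMass hs) (by fun_prop)

lemma continuous_greenField_right (hs : 0 < s) (x : Pt) : Continuous (greenField s x) :=
  (contDiff_greenField hs x).continuous

variable {x y : Pt}

lemma green_nonneg (hs : 0 < s) (hx : x ∈ B) (hy : y ∈ B) : 0 ≤ green s x y := by
  have h1 := distQuad_nonneg x y
  have h2 := distQuad_le_imageQuad hx hy
  exact sub_nonneg.2 (Real.log_le_log (by linarith) (by linarith))

lemma green_le (hs : 0 < s) (hx : x ∈ B) (hy : y ∈ B) : green s x y ≤ (1 - ‖y‖ ^ 2) / s := by
  have h1 := distQuad_nonneg x y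
  have h2 := distQuad_le_imageQuad hx hy
  have hy' := one_sub_sq_pos hy
  have h3 : imageQuad x y - distQuad x y ≤ 1 - ‖y‖ ^ 2 := by
    rw [imageQuad_sub_distQuad]
    nlinarith [mul_nonneg (sq_nonneg ‖x‖) hy'.le]
  unfold green
  rw [← Real.log_div (by linarith) (by linarith)]
  refine (Real.log_le_sub_one_of_pos (div_pos (by linarith) (by linarith))).trans ?_
  rw [div_sub_one (by linarith)]
  exact div_le_div₀ hy'.le (by linarith) hs (by linarith)

lemma green_le_inv (hs : 0 < s) (hx : x ∈ B) (hy : y ∈ B) : green s x y ≤ 1 / s :=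
  (green_le hs hx hy).trans (by gcongr; linarith [sq_nonneg ‖y‖])

lemma norm_logQuadField_le {a b : ℝ} (hs : 0 < s) (ha0 : 0 ≤ a) (ha : a ≤ 1) (hx : x ∈ B) (hy : y ∈ B)
    (h : 0 ≤ planeQuad a b x y) : ‖logQuadField s a b x y‖ ≤ 4 / s := by
  have h1 := (mem_B_iff.1 hx).le
  have h2 := (mem_B_iff.1 hy).le
  have h3 : ‖(2 * a) • y - (2 : ℝ) • x‖ ≤ 4 := by
    refine (norm_sub_le _ _).trans ?_
    rw [norm_smul, norm_smul, Real.norm_eq_abs, Real.norm_eq_abs, abs_of_nonneg (by positivity), abs_two]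
    nlinarith [norm_nonneg y, mul_nonneg ha0 (norm_nonneg y)]
  rw [logQuadField, norm_smul, norm_inv, Real.norm_eq_abs, abs_of_nonneg (by linarith),
    inv_mul_eq_div]
  exact div_le_div₀ (by norm_num) h3 hs (by linarith)

lemma norm_greenField_le (hs : 0 < s) (hx : x ∈ B) (hy : y ∈ B) : ‖greenField s x y‖ ≤ 8 / s := by
  have h1 : ‖x‖ ^ 2 ≤ 1 := by linarith [one_sub_sq_pos hx]
  refine (norm_sub_le _ _).trans ((add_le_add
    (norm_logQuadField_le hs (by positivity) h1 hx hy (imageQuad_nonneg x y))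
    (norm_logQuadField_le hs zero_le_one le_rfl hx hy (distQuad_nonneg x y))).trans_eq ?_)
  ring

lemma greenMass_le (hs : 0 < s) : greenMass s x y ≤ 4 * s / (distQuad x y + s) ^ 2 :=
  sub_le_self _ (by positivity)

lemma greenMass_nonneg (hs : 0 < s) (hx : x ∈ B) (hy : y ∈ B) : 0 ≤ greenMass s x y := by
  have h1 := distQuad_nonneg x y
  have h2 := distQuad_le_imageQuad hx hy
  have h3 : ‖x‖ ^ 2 ≤ 1 := by linarith [one_sub_sq_pos hx]
  refine sub_nonneg.2 (div_le_div₀ (by positivity) (by nlinarith) (by positivity) (by gcongr))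

lemma isH1_green (hs : 0 < s) (hx : x ∈ B) : IsH1 (green s x) := by
  have hc : Continuous (green s x) := continuous_green_right hs x
  have hcf : Continuous (greenField s x) := continuous_greenField_right hs x
  refine ⟨fun y _ => (gradient_green hs x y).differentiableAt.differentiableWithinAt, ?_, ?_⟩
  · simp_rw [gradient_green_eq hs]
    refine Integrable.mono' (integrable_const ((8 / s) ^ 2)) (by fun_prop) ?_
    filter_upwards [ae_restrict_mem measurableSet_B] with y hy
    rw [Real.norm_eq_abs, abs_of_nonneg (by positivity)]
    gcongr
    exact norm_greenField_le hs hx hy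
  · refine Integrable.mono' (integrable_const (4 / s ^ 2)) ?_ ?_
    · exact ((hc.pow 2).measurable.mul measurable_dens).aestronglyMeasurable
    filter_upwards [ae_restrict_mem measurableSet_B] with y hy
    have hp := one_sub_sq_pos hy
    rw [Real.norm_eq_abs, abs_of_nonneg (mul_nonneg (sq_nonneg _) (dens_nonneg _))]
    calc green s x y ^ 2 * dens y ≤ ((1 - ‖y‖ ^ 2) / s) ^ 2 * dens y := by
          have := dens_nonneg y
          gcongr
          · exact green_nonneg hs hx hy
          · exact green_le hs hx hy
      _ = 4 / s ^ 2 := by unfold dens; field_simp; norm_num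

lemma IsH1.integrable_one_add {u : Pt → ℝ} (hu : IsH1 u) :
    IntegrableOn (fun y => 1 + u y ^ 2 * dens y) B :=
  (integrable_const (1 : ℝ)).add hu.2.2

lemma abs_div_one_sub_sq_le (t : ℝ) (hy : y ∈ B) :
    |t| / (1 - ‖y‖ ^ 2) ≤ 1 + t ^ 2 * dens y := by
  have hp := one_sub_sq_pos hy
  have : t ^ 2 * dens y = 4 * (|t| / (1 - ‖y‖ ^ 2)) ^ 2 := by
    unfold dens; rw [div_pow, div_pow, sq_abs]; ring
  rw [this]
  nlinarith [sq_nonneg (|t| / (1 - ‖y‖ ^ 2) - 1), sq_nonneg (|t| / (1 - ‖y‖ ^ 2))]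

lemma IsH1.integrableOn {u : Pt → ℝ} (hu : IsH1 u) : IntegrableOn u B := by
  refine Integrable.mono' hu.integrable_one_add hu.aestronglyMeasurable ?_
  filter_upwards [ae_restrict_mem measurableSet_B] with y hy
  refine le_trans ?_ (abs_div_one_sub_sq_le (u y) hy)
  have hp := one_sub_sq_pos hy
  rw [le_div_iff₀ hp, Real.norm_eq_abs]
  nlinarith [abs_nonneg (u y), mul_nonneg (abs_nonneg (u y)) (sq_nonneg ‖y‖)]

/-- Functions of bounded Dirichlet energy are integrated against the Green kernel. -/
lemma IsH1.integral_inner_greenField {u : Pt → ℝ} (hu : IsH1 u) (hs : 0 < s) (hx : x ∈ B) :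
    ∫ y in B, inner ℝ (gradient u y) (greenField s x y) = ∫ y in B, u y * greenMass s x y := by
  have hcf : Continuous (greenField s x) := continuous_greenField_right hs x
  have hcm : Continuous (greenMass s x) := continuous_greenMass_right hs x
  have hdom := hu.integrable_one_add
  have hui := hu.integrableOn
  have hmb : ∃ C, ∀ y ∈ B, ‖greenMass s x y‖ ≤ C := by
    obtain ⟨C, hC⟩ := (isCompact_closedBall (0 : Pt) 1).exists_bound_of_continuousOn hcm.continuousOn
    exact ⟨C, fun y hy => hC y (Metric.ball_subset_closedBall hy)⟩
  obtain ⟨C, hC⟩ := hmb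
  have h := integral_inner_gradient (X := greenField s x) hu.1 hu.integrable_gradient
    (contDiff_greenField hs x).contDiffOn ?_ ?_ ?_
  · simp_rw [divergence_greenField hs, mul_neg, integral_neg, neg_neg] at h
    exact h
  · refine Integrable.mono' (hu.integrable_gradient.norm.mul_const (8 / s))
      ((measurable_gradient u).aestronglyMeasurable.inner hcf.aestronglyMeasurable) ?_
    filter_upwards [ae_restrict_mem measurableSet_B] with y hy
    refine (norm_inner_le_norm _ _).trans ?_
    gcongr
    exact norm_greenField_le hs hx hy
  · simp_rw [divergence_greenField hs]
    refine Integrable.mul_bdd (c := C) hui hcm.neg.aestronglyMeasurable ?_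
    filter_upwards [ae_restrict_mem measurableSet_B] with y hy
    rw [norm_neg]; exact hC y hy
  · refine Integrable.mono' (hdom.const_mul (8 / s)) ?_ ?_
    · refine ((hu.1.continuousOn.abs.mul hcf.continuousOn.norm).div (by fun_prop)
        fun y hy => (one_sub_sq_pos hy).ne').aestronglyMeasurable measurableSet_B
    · filter_upwards [ae_restrict_mem measurableSet_B] with y hy
      have hp := one_sub_sq_pos hy
      rw [Real.norm_eq_abs, abs_of_nonneg (by positivity)]
      calc |u y| * ‖greenField s x y‖ / (1 - ‖y‖ ^ 2)
          = ‖greenField s x y‖ * (|u y| / (1 - ‖y‖ ^ 2)) := by ring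
        _ ≤ 8 / s * (1 + u y ^ 2 * dens y) :=
          mul_le_mul (norm_greenField_le hs hx hy) (abs_div_one_sub_sq_le (u y) hy) (by positivity) (by positivity)

end

/-- The Cauchy-type probability density on the plane. -/
def planeKernel (z : Pt) : ℝ := (π * (1 + ‖z‖ ^ 2) ^ 2)⁻¹

lemma planeKernel_nonneg (z : Pt) : 0 ≤ planeKernel z := by unfold planeKernel; positivity

lemma volume_real_unit_ball : (volume : Measure Pt).real (Metric.ball 0 1) = π := by
  simp [Measure.real, EuclideanSpace.volume_ball_fin_two, Real.pi_pos.le]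

lemma integral_planeKernel : ∫ z, planeKernel z = 1 := by
  have h := integral_fun_norm_addHaar (volume : Measure Pt) (fun r : ℝ => (π * (1 + r ^ 2) ^ 2)⁻¹)
  have h2 : ∫ r in Ioi (0 : ℝ), r * (π * (1 + r ^ 2) ^ 2)⁻¹ = 0 - -(2 * π * (1 + (0 : ℝ) ^ 2))⁻¹ := by
    refine integral_Ioi_of_hasDerivAt_of_nonneg' (g := fun r => -(2 * π * (1 + r ^ 2))⁻¹) ?_ ?_ ?_
    · intro r _
      have hp : 2 * π * (1 + r ^ 2) ≠ 0 := by positivity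
      have := ((((hasDerivAt_pow 2 r).const_add 1).const_mul (2 * π)).inv hp).neg
      refine this.congr_deriv ?_
      have : π ≠ 0 := Real.pi_ne_zero
      field_simp
      ring
    · intro r hr
      have : (0 : ℝ) < r := hr
      positivity
    · rw [← neg_zero]
      refine (tendsto_inv_atTop_zero.comp ?_).neg
      refine Tendsto.const_mul_atTop (by positivity) ?_
      exact tendsto_atTop_add_const_left _ _ (tendsto_pow_atTop two_ne_zero)
  simp only [finrank_euclideanSpace, Fintype.card_fin, volume_real_unit_ball, smul_eq_mul,
    Nat.add_one_sub_one, pow_one, nsmul_eq_mul, Nat.cast_ofNat] at h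
  unfold planeKernel
  rw [h, h2]
  have : π ≠ 0 := Real.pi_ne_zero
  field_simp
  norm_num

lemma tendsto_planeKernel :
    Tendsto (fun z : Pt => ‖z‖ ^ Module.finrank ℝ Pt * planeKernel z) (Bornology.cobounded Pt)
      (nhds 0) := by
  have h1 : Tendsto (fun z : Pt => (‖z‖ ^ 2)⁻¹) (Bornology.cobounded Pt) (nhds 0) :=
    tendsto_inv_atTop_zero.comp ((tendsto_pow_atTop two_ne_zero).comp tendsto_norm_cobounded_atTop)
  refine squeeze_zero (fun z => mul_nonneg (by positivity) (planeKernel_nonneg z)) (fun z => ?_) h1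
  simp only [finrank_euclideanSpace, Fintype.card_fin, planeKernel]
  rcases eq_or_ne z 0 with rfl | hz
  · simp
  have hn : 0 < ‖z‖ := norm_pos_iff.2 hz
  rw [mul_inv_le_iff₀ (by positivity), ← div_eq_inv_mul, le_div_iff₀ (by positivity)]
  have := Real.pi_gt_three
  nlinarith [pow_pos hn 4, pow_pos hn 2, mul_pos (pow_pos hn 2) Real.pi_pos, mul_pos (pow_pos hn 4) Real.pi_pos]

lemma mass_eq_planeKernel {c : ℝ} (hc : 0 < c) (x y : Pt) :
    4 * (c ^ 2)⁻¹ / (distQuad x y + (c ^ 2)⁻¹) ^ 2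
      = 4 * π * (c ^ Module.finrank ℝ Pt * planeKernel (c • (x - y))) := by
  simp only [finrank_euclideanSpace, Fintype.card_fin, planeKernel]
  rw [distQuad_eq, norm_smul, mul_pow, Real.norm_eq_abs, sq_abs]
  have h1 : 0 < 1 + c ^ 2 * ‖x - y‖ ^ 2 := by positivity
  have h2 : ‖x - y‖ ^ 2 + (c ^ 2)⁻¹ = (1 + c ^ 2 * ‖x - y‖ ^ 2) / c ^ 2 := by
    field_simp; ring
  rw [h2]
  have := Real.pi_ne_zero
  field_simp

lemma integral_scaled_planeKernel {c : ℝ} (hc : 0 < c) (x : Pt) :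
    ∫ y, c ^ Module.finrank ℝ Pt * planeKernel (c • (x - y)) = 1 := by
  rw [integral_const_mul, integral_sub_left_eq_self (fun z => planeKernel (c • z)),
    Measure.integral_comp_smul, integral_planeKernel, abs_of_pos (by positivity)]
  simp [hc.ne']

section
variable {s : ℝ} {x : Pt}

lemma integral_greenMass_le (hs : 0 < s) (hx : x ∈ B) : ∫ y in B, greenMass s x y ≤ 4 * π := by
  obtain ⟨c, hc, rfl⟩ : ∃ c : ℝ, 0 < c ∧ s = (c ^ 2)⁻¹ :=
    ⟨(√s)⁻¹, by positivity, by rw [inv_pow, Real.sq_sqrt hs.le, inv_inv]⟩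
  have hI : Integrable fun y => c ^ Module.finrank ℝ Pt * planeKernel (c • (x - y)) :=
    integrable_of_integral_eq_one (integral_scaled_planeKernel hc x)
  have hp : ∀ y, 0 ≤ 4 * π * (c ^ Module.finrank ℝ Pt * planeKernel (c • (x - y))) := fun y =>
    mul_nonneg (by positivity) (mul_nonneg (by positivity) (planeKernel_nonneg _))
  calc ∫ y in B, greenMass (c ^ 2)⁻¹ x y
      ≤ ∫ y in B, 4 * π * (c ^ Module.finrank ℝ Pt * planeKernel (c • (x - y))) := by
        refine integral_mono_of_nonneg ?_ (hI.const_mul _).integrableOn ?_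
        · filter_upwards [ae_restrict_mem measurableSet_B] with y hy
          exact greenMass_nonneg hs hx hy
        · exact Eventually.of_forall fun y => (greenMass_le hs).trans_eq (mass_eq_planeKernel hc x y)
    _ ≤ ∫ y, 4 * π * (c ^ Module.finrank ℝ Pt * planeKernel (c • (x - y))) :=
        setIntegral_le_integral (hI.const_mul _) (Eventually.of_forall hp)
    _ = 4 * π := by rw [integral_const_mul, integral_scaled_planeKernel hc, mul_one]

lemma one_sub_sq_le_imageQuad {y : Pt} (hx : x ∈ B) (hy : y ∈ B) :
    (1 - ‖x‖) ^ 2 ≤ imageQuad x y := by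
  have h1 := real_inner_le_norm x y
  have h2 := mem_B_iff.1 hx
  have h3 := mem_B_iff.1 hy
  have h4 : (1 - ‖x‖ * ‖y‖) ^ 2 ≤ imageQuad x y := by unfold imageQuad planeQuad; nlinarith
  refine le_trans ?_ h4
  have : ‖x‖ * ‖y‖ ≤ ‖x‖ := mul_le_of_le_one_right (norm_nonneg _) h3.le
  gcongr

lemma IsH1.tendsto_integral_greenMass {u : Pt → ℝ} (hu : IsH1 u) (hx : x ∈ B) :
    Tendsto (fun c : ℝ => ∫ y in B, u y * greenMass (c ^ 2)⁻¹ x y) atTop (nhds (4 * π * u x)) := by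
  have hcont : ContinuousAt (B.indicator u) x := by
    refine ((hu.1 x hx).differentiableAt (isOpen_B.mem_nhds hx)).continuousAt.congr ?_
    filter_upwards [isOpen_B.mem_nhds hx] with y hy
    rw [indicator_of_mem hy]
  have h1 := tendsto_integral_comp_smul_smul_of_integrable' (μ := (volume : Measure Pt))
    planeKernel_nonneg integral_planeKernel tendsto_planeKernel
    ((integrable_indicator_iff measurableSet_B).2 hu.integrableOn) hcont
  rw [indicator_of_mem hx] at h1
  have hr : 0 < (1 - ‖x‖) ^ 2 := pow_pos (by linarith [mem_B_iff.1 hx]) 2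
  set δ := ((1 - ‖x‖) ^ 2) ^ 2 with hδ
  have hδ0 : 0 < δ := by positivity
  have hbound : ∀ c : ℝ, 0 < c → ∀ y ∈ B,
      ‖4 * ‖x‖ ^ 2 * (c ^ 2)⁻¹ / (imageQuad x y + (c ^ 2)⁻¹) ^ 2‖ ≤ 4 / δ * (c ^ 2)⁻¹ := by
    intro c hc y hy
    have h2 := one_sub_sq_le_imageQuad hx hy
    have h3 : ‖x‖ ^ 2 ≤ 1 := by linarith [one_sub_sq_pos hx]
    rw [Real.norm_eq_abs, abs_of_nonneg (by positivity), div_mul_eq_mul_div]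
    have h4 : 0 < (c ^ 2)⁻¹ := by positivity
    refine div_le_div₀ (by positivity) (by nlinarith) hδ0 ?_
    rw [hδ]; gcongr; linarith
  have hmeas : ∀ c : ℝ, 0 < c → Continuous
      fun y => 4 * ‖x‖ ^ 2 * (c ^ 2)⁻¹ / (imageQuad x y + (c ^ 2)⁻¹) ^ 2 := fun c hc => by
    have hc' : Continuous fun y => imageQuad x y := by unfold imageQuad planeQuad; fun_prop
    exact continuous_const.div ((hc'.add continuous_const).pow 2) fun y =>
      (pow_pos (add_pos_of_nonneg_of_pos (imageQuad_nonneg x y) (by positivity)) 2).ne'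
  have hInteg : ∀ c : ℝ, 0 < c → IntegrableOn
      (fun y => u y * (4 * ‖x‖ ^ 2 * (c ^ 2)⁻¹ / (imageQuad x y + (c ^ 2)⁻¹) ^ 2)) B := by
    intro c hc
    refine Integrable.mul_bdd (c := 4 / δ * (c ^ 2)⁻¹) hu.integrableOn
      (hmeas c hc).aestronglyMeasurable ?_
    filter_upwards [ae_restrict_mem measurableSet_B] with y hy using hbound c hc y hy
  have h2 : Tendsto (fun c : ℝ => ∫ y in B,
      u y * (4 * ‖x‖ ^ 2 * (c ^ 2)⁻¹ / (imageQuad x y + (c ^ 2)⁻¹) ^ 2)) atTop (nhds 0) := by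
    have h3 : Tendsto (fun c : ℝ => (∫ y in B, ‖u y‖) * (4 / δ * (c ^ 2)⁻¹)) atTop (nhds 0) := by
      have : Tendsto (fun c : ℝ => (c ^ 2)⁻¹) atTop (nhds 0) :=
        tendsto_inv_atTop_zero.comp (tendsto_pow_atTop two_ne_zero)
      simpa using (this.const_mul (4 / δ)).const_mul (∫ y in B, ‖u y‖)
    refine squeeze_zero_norm' ?_ h3
    filter_upwards [eventually_gt_atTop 0] with c hc
    rw [← integral_mul_const]
    refine norm_integral_le_of_norm_le (hu.integrableOn.norm.mul_const _) ?_
    filter_upwards [ae_restrict_mem measurableSet_B] with y hy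
    rw [norm_mul]
    gcongr
    exact hbound c hc y hy
  have h3 := (h1.const_mul (4 * π)).sub h2
  rw [sub_zero] at h3
  refine h3.congr' ?_
  filter_upwards [eventually_gt_atTop 0] with c hc
  have e1 : ∫ y, (c ^ Module.finrank ℝ Pt * planeKernel (c • (x - y))) • B.indicator u y
      = ∫ y in B, (c ^ Module.finrank ℝ Pt * planeKernel (c • (x - y))) * u y := by
    rw [← integral_indicator measurableSet_B]
    congr 1 with y
    by_cases hy : y ∈ B <;> simp [hy]
  have hint1 : IntegrableOn
      (fun y => 4 * π * ((c ^ Module.finrank ℝ Pt * planeKernel (c • (x - y))) * u y)) B := by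
    have hcd : Continuous fun y => 4 * (c ^ 2)⁻¹ / (distQuad x y + (c ^ 2)⁻¹) ^ 2 := by
      have hc' : Continuous fun y => distQuad x y := by unfold distQuad planeQuad; fun_prop
      exact continuous_const.div ((hc'.add continuous_const).pow 2) fun y =>
        (pow_pos (add_pos_of_nonneg_of_pos (distQuad_nonneg x y) (by positivity)) 2).ne'
    obtain ⟨C, hC⟩ := (isCompact_closedBall (0 : Pt) 1).exists_bound_of_continuousOn hcd.continuousOn
    refine (Integrable.mul_bdd (c := C) hu.integrableOn hcd.aestronglyMeasurable ?_).congr ?_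
    · filter_upwards [ae_restrict_mem measurableSet_B] with y hy
        using hC y (Metric.ball_subset_closedBall hy)
    · filter_upwards with y
      rw [mass_eq_planeKernel hc]; ring
  rw [e1, ← integral_const_mul, ← integral_sub hint1 (hInteg c hc)]
  refine integral_congr_ae (Eventually.of_forall fun y => ?_)
  simp only [greenMass]
  rw [mass_eq_planeKernel hc]
  ring

end

section gibbs
variable {α : Type*} [MeasurableSpace α] {μ : Measure α} [IsFiniteMeasure μ]

lemma integrable_exp_of_bound {V : α → ℝ} (hV : AEStronglyMeasurable V μ) {b : ℝ}
    (hb : ∀ᵐ x ∂μ, ‖V x‖ ≤ b) : Integrable (fun x => Real.exp (V x)) μ := by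
  refine Integrable.of_bound (Real.continuous_exp.comp_aestronglyMeasurable hV) (Real.exp b) ?_
  filter_upwards [hb] with x hx
  rw [Real.norm_eq_abs, Real.abs_exp]
  exact Real.exp_le_exp.2 ((le_abs_self _).trans hx)

/-- The Gibbs variational inequality for bounded functions. -/
lemma integral_tilted_le [NeZero μ] {V φ : α → ℝ} (hV : AEStronglyMeasurable V μ)
    (hφ : AEStronglyMeasurable φ μ) {b b' C : ℝ} (hb : ∀ᵐ x ∂μ, ‖V x‖ ≤ b)
    (hb' : ∀ᵐ x ∂μ, ‖φ x‖ ≤ b') (hC : 0 < C) (h : ∫ x, Real.exp (φ x) ∂μ ≤ C) :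
    ∫ x, φ x ∂(μ.tilted V) ≤
      ∫ x, V x ∂(μ.tilted V) - Real.log (∫ x, Real.exp (V x) ∂μ) + Real.log C := by
  have hVi := integrable_exp_of_bound hV hb
  have hφi := integrable_exp_of_bound hφ hb'
  have := isProbabilityMeasure_tilted hVi
  have hac := tilted_absolutelyContinuous μ V
  set Z := ∫ x, Real.exp (V x) ∂μ with hZ
  have hZ0 : 0 < Z := integral_exp_pos hVi
  have hVQ : Integrable V (μ.tilted V) := Integrable.of_bound (hV.mono_ac hac) b (hac.ae_le hb)
  have hφQ : Integrable φ (μ.tilted V) := Integrable.of_bound (hφ.mono_ac hac) b' (hac.ae_le hb')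
  have hEQ : Integrable (fun x => Real.exp (φ x - V x) * (Z / C)) (μ.tilted V) := by
    refine (integrable_exp_of_bound (b := b' + b) ((hφ.sub hV).mono_ac hac) ?_).mul_const _
    filter_upwards [hac.ae_le hb, hac.ae_le hb'] with x h1 h2
    exact (norm_sub_le _ _).trans (add_le_add h2 h1)
  have hE : ∫ x, Real.exp (φ x - V x) * (Z / C) ∂(μ.tilted V) ≤ 1 := by
    rw [integral_tilted]
    calc ∫ x, (Real.exp (V x) / Z) • (Real.exp (φ x - V x) * (Z / C)) ∂μ
        = ∫ x, Real.exp (φ x) * C⁻¹ ∂μ := by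
          congr 1 with x
          rw [Real.exp_sub, smul_eq_mul]
          have := Real.exp_pos (V x)
          field_simp
      _ = (∫ x, Real.exp (φ x) ∂μ) * C⁻¹ := integral_mul_const _ _
      _ ≤ 1 := by rw [mul_inv_le_iff₀ hC]; linarith
  have hpt : ∀ x, φ x ≤ V x - Real.log Z + Real.log C + (Real.exp (φ x - V x) * (Z / C) - 1) := by
    intro x
    have h1 := Real.add_one_le_exp (φ x - V x + Real.log Z - Real.log C)
    have h2 : Real.exp (φ x - V x + Real.log Z - Real.log C) = Real.exp (φ x - V x) * (Z / C) := by
      rw [Real.exp_sub, Real.exp_add, Real.exp_log hZ0, Real.exp_log hC]; ring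
    linarith
  have i1 : Integrable (fun x => V x - Real.log Z) (μ.tilted V) := hVQ.sub (integrable_const _)
  have i2 : Integrable (fun x => V x - Real.log Z + Real.log C) (μ.tilted V) :=
    i1.add (integrable_const _)
  have i3 : Integrable (fun x => Real.exp (φ x - V x) * (Z / C) - 1) (μ.tilted V) :=
    hEQ.sub (integrable_const _)
  have h3 := integral_mono hφQ (i2.add i3) hpt
  have h4 : ∫ x, (V x - Real.log Z + Real.log C + (Real.exp (φ x - V x) * (Z / C) - 1)) ∂(μ.tilted V)
      = ∫ x, V x ∂(μ.tilted V) - Real.log Z + Real.log C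
        + (∫ x, Real.exp (φ x - V x) * (Z / C) ∂(μ.tilted V) - 1) := by
    rw [integral_add i2 i3, integral_add i1 (integrable_const _),
      integral_sub hVQ (integrable_const _), integral_sub hEQ (integrable_const _)]
    simp
  have h5 : ∫ x, φ x ∂(μ.tilted V) ≤ ∫ x, V x ∂(μ.tilted V) - Real.log Z + Real.log C
        + (∫ x, Real.exp (φ x - V x) * (Z / C) ∂(μ.tilted V) - 1) := h3.trans_eq h4
  linarith

end gibbs

section
variable {s : ℝ} {Q : Measure Pt} [IsProbabilityMeasure Q]

lemma integral_greenField_inner_le (hs : 0 < s) (hQ : ∀ᵐ x ∂Q, x ∈ B) {E : ℝ}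
    (hE : ∀ y ∈ B, ∫ x, green s x y ∂Q ≤ E) :
    ∫ y in B, ‖∫ x, greenField s x y ∂Q‖ ^ 2 ≤ 4 * π * E := by
  set W : Pt → Pt := fun y => ∫ x, greenField s x y ∂Q with hW
  have hWm : StronglyMeasurable W :=
    StronglyMeasurable.integral_prod_left (f := fun x y => greenField s x y)
      (continuous_greenField hs).stronglyMeasurable
  have hWb : ∀ y ∈ B, ‖W y‖ ≤ 8 / s := fun y hy => by
    refine (norm_integral_le_of_norm_le_const (C := 8 / s) ?_).trans_eq (by simp)
    filter_upwards [hQ] with x hx using norm_greenField_le hs hx hy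
  have hgi : ∀ y ∈ B, Integrable (fun x => greenField s x y) Q := fun y hy => by
    have hc : Continuous fun x => greenField s x y :=
      Continuous.comp (g := fun p : Pt × Pt => greenField s p.1 p.2) (f := fun x => (x, y))
        (continuous_greenField hs) (by fun_prop)
    refine Integrable.of_bound hc.aestronglyMeasurable (8 / s) ?_
    filter_upwards [hQ] with x hx using norm_greenField_le hs hx hy
  have hprod : ∀ᵐ p ∂(Q.prod (volume.restrict B)), p.1 ∈ B ∧ p.2 ∈ B := by
    filter_upwards [Measure.quasiMeasurePreserving_fst.ae hQ,
      Measure.quasiMeasurePreserving_snd.ae (ae_restrict_mem measurableSet_B)] with p h1 h2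
      using ⟨h1, h2⟩
  have hE0 : 0 ≤ E := by
    have h0 : (0 : Pt) ∈ B := by simp [B]
    refine le_trans (integral_nonneg_of_ae ?_) (hE 0 h0)
    filter_upwards [hQ] with x hx using green_nonneg hs hx h0
  have key : ∀ x ∈ B, ∫ y in B, inner ℝ (W y) (greenField s x y) ≤ 4 * π * E := by
    intro x hx
    have hc := continuous_greenField_right hs x
    have hm := continuous_greenMass_right hs x
    obtain ⟨M, hM⟩ := (isCompact_closedBall (0 : Pt) 1).exists_bound_of_continuousOn hm.continuousOn
    have hgx : ∀ y ∈ B, ‖greenMass s x y‖ ≤ M := fun y hy => hM y (Metric.ball_subset_closedBall hy)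
    have hM0 : 0 ≤ M := (norm_nonneg _).trans (hgx x hx)
    have hi1 : Integrable (Function.uncurry fun x' y => inner ℝ (greenField s x' y) (greenField s x y))
        (Q.prod (volume.restrict B)) := by
      refine Integrable.of_bound ?_ (8 / s * (8 / s)) ?_
      · exact ((continuous_greenField hs).inner (hc.comp continuous_snd)).aestronglyMeasurable
      · filter_upwards [hprod] with p hp
        refine (norm_inner_le_norm _ _).trans ?_
        gcongr
        · exact norm_greenField_le hs hp.1 hp.2
        · exact norm_greenField_le hs hx hp.2
    have hi2 : Integrable (Function.uncurry fun x' y => green s x' y * greenMass s x y)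
        (Q.prod (volume.restrict B)) := by
      refine Integrable.of_bound ?_ (1 / s * M) ?_
      · exact ((continuous_green hs).mul (hm.comp continuous_snd)).aestronglyMeasurable
      · filter_upwards [hprod] with p hp
        rw [Function.uncurry, norm_mul]
        gcongr
        · rw [Real.norm_eq_abs, abs_of_nonneg (green_nonneg hs hp.1 hp.2)]
          exact green_le_inv hs hp.1 hp.2
        · exact hgx _ hp.2
    calc ∫ y in B, inner ℝ (W y) (greenField s x y)
        = ∫ y in B, ∫ x', inner ℝ (greenField s x' y) (greenField s x y) ∂Q := by
          refine setIntegral_congr_fun measurableSet_B fun y hy => ?_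
          rw [real_inner_comm, ← integral_inner (hgi y hy)]
          simp_rw [real_inner_comm]
      _ = ∫ x', (∫ y in B, inner ℝ (greenField s x' y) (greenField s x y)) ∂Q :=
          (integral_integral_swap hi1).symm
      _ = ∫ x', (∫ y in B, green s x' y * greenMass s x y) ∂Q := by
          refine integral_congr_ae ?_
          filter_upwards [hQ] with x' hx'
          rw [← (isH1_green hs hx').integral_inner_greenField hs hx]
          simp_rw [gradient_green_eq hs]
      _ = ∫ y in B, ∫ x', green s x' y * greenMass s x y ∂Q := integral_integral_swap hi2
      _ ≤ ∫ y in B, E * greenMass s x y := by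
          refine integral_mono_ae hi2.integral_prod_right ?_ ?_
          · refine (Integrable.of_bound hm.aestronglyMeasurable M ?_).const_mul E
            filter_upwards [ae_restrict_mem measurableSet_B] with y hy using hgx y hy
          · filter_upwards [ae_restrict_mem measurableSet_B] with y hy
            rw [integral_mul_const]
            exact mul_le_mul_of_nonneg_right (hE y hy) (greenMass_nonneg hs hx hy)
      _ ≤ E * (4 * π) := by
          rw [integral_const_mul]
          exact mul_le_mul_of_nonneg_left (integral_greenMass_le hs hx) hE0
      _ = 4 * π * E := mul_comm _ _
  have hi : Integrable (Function.uncurry fun x y => inner ℝ (W y) (greenField s x y))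
      (Q.prod (volume.restrict B)) := by
    refine Integrable.of_bound ?_ (8 / s * (8 / s)) ?_
    · exact (hWm.aestronglyMeasurable.comp_snd).inner (continuous_greenField hs).aestronglyMeasurable
    · filter_upwards [hprod] with p hp
      refine (norm_inner_le_norm _ _).trans ?_
      gcongr
      · exact hWb _ hp.2
      · exact norm_greenField_le hs hp.1 hp.2
  calc ∫ y in B, ‖W y‖ ^ 2 = ∫ y in B, ∫ x, inner ℝ (W y) (greenField s x y) ∂Q := by
        refine setIntegral_congr_fun measurableSet_B fun y hy => ?_
        rw [integral_inner (hgi y hy), real_inner_self_eq_norm_sq]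
    _ = ∫ x, (∫ y in B, inner ℝ (W y) (greenField s x y)) ∂Q := (integral_integral_swap hi).symm
    _ ≤ ∫ x, 4 * π * E ∂Q := by
        refine integral_mono_ae hi.integral_prod_left (integrable_const _) ?_
        filter_upwards [hQ] with x hx using key x hx
    _ = 4 * π * E := by simp

end

section
variable {s : ℝ} {u : Pt → ℝ}

lemma stronglyMeasurable_greenPotential (hs : 0 < s) :
    StronglyMeasurable fun x => ∫ y in B, inner ℝ (gradient u y) (greenField s x y) :=
  StronglyMeasurable.integral_prod_right
    (f := fun x y => inner ℝ (gradient u y) (greenField s x y))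
    (((measurable_gradient u).comp measurable_snd).stronglyMeasurable.inner
      (continuous_greenField hs).stronglyMeasurable)

lemma norm_greenPotential_le (hu : IsH1 u) (hs : 0 < s) {x : Pt} (hx : x ∈ B) :
    ‖∫ y in B, inner ℝ (gradient u y) (greenField s x y)‖ ≤ ∫ y in B, ‖gradient u y‖ * (8 / s) := by
  refine norm_integral_le_of_norm_le (hu.integrable_gradient.norm.mul_const _) ?_
  filter_upwards [ae_restrict_mem measurableSet_B] with y hy
  refine (norm_inner_le_norm _ _).trans ?_
  gcongr
  exact norm_greenField_le hs hx hy

lemma integral_greenPotential_le {Q : Measure Pt} [IsProbabilityMeasure Q] (hu : IsH1 u)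
    (hE : enormSq u ≤ 1) (hs : 0 < s) (hQ : ∀ᵐ x ∂Q, x ∈ B) {θ : ℝ} (hθ : 0 < θ) {E : ℝ}
    (hG : ∀ y ∈ B, ∫ x, green s x y ∂Q ≤ E) (σ : ℝ) :
    σ * ∫ x, (∫ y in B, inner ℝ (gradient u y) (greenField s x y)) ∂Q ≤ π * σ ^ 2 / θ + θ * E := by
  set W : Pt → Pt := fun y => ∫ x, greenField s x y ∂Q with hW
  have hWm : StronglyMeasurable W :=
    StronglyMeasurable.integral_prod_left (f := fun x y => greenField s x y)
      (continuous_greenField hs).stronglyMeasurable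
  have hWb : ∀ y ∈ B, ‖W y‖ ≤ 8 / s := fun y hy => by
    refine (norm_integral_le_of_norm_le_const (C := 8 / s) ?_).trans_eq (by simp)
    filter_upwards [hQ] with x hx using norm_greenField_le hs hx hy
  have hgi : ∀ y ∈ B, Integrable (fun x => greenField s x y) Q := fun y hy => by
    have hc : Continuous fun x => greenField s x y :=
      Continuous.comp (g := fun p : Pt × Pt => greenField s p.1 p.2) (f := fun x => (x, y))
        (continuous_greenField hs) (by fun_prop)
    refine Integrable.of_bound hc.aestronglyMeasurable (8 / s) ?_
    filter_upwards [hQ] with x hx using norm_greenField_le hs hx hy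
  have hi : Integrable (Function.uncurry fun x y => inner ℝ (gradient u y) (greenField s x y))
      (Q.prod (volume.restrict B)) := by
    refine Integrable.mono' ((hu.integrable_gradient.norm.mul_const (8 / s)).comp_snd Q) ?_ ?_
    · exact (((measurable_gradient u).comp measurable_snd).stronglyMeasurable.inner
        (continuous_greenField hs).stronglyMeasurable).aestronglyMeasurable
    · filter_upwards [Measure.quasiMeasurePreserving_fst.ae hQ,
        Measure.quasiMeasurePreserving_snd.ae (ae_restrict_mem measurableSet_B)] with p h1 h2
      refine (norm_inner_le_norm _ _).trans ?_
      gcongr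
      exact norm_greenField_le hs h1 h2
  have hswap : ∫ x, (∫ y in B, inner ℝ (gradient u y) (greenField s x y)) ∂Q
      = ∫ y in B, inner ℝ (gradient u y) (W y) := by
    rw [integral_integral_swap hi]
    refine setIntegral_congr_fun measurableSet_B fun y hy => ?_
    exact integral_inner (hgi y hy) _
  have hW2 : IntegrableOn (fun y => ‖W y‖ ^ 2) B := by
    refine Integrable.of_bound (hWm.norm.pow 2).aestronglyMeasurable ((8 / s) ^ 2) ?_
    filter_upwards [ae_restrict_mem measurableSet_B] with y hy
    rw [norm_pow, norm_norm]
    gcongr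
    exact hWb y hy
  have hW3 := integral_greenField_inner_le hs hQ hG
  have hpi := Real.pi_pos
  calc σ * ∫ x, (∫ y in B, inner ℝ (gradient u y) (greenField s x y)) ∂Q
      = ∫ y in B, σ * inner ℝ (gradient u y) (W y) := by rw [hswap, integral_const_mul]
    _ ≤ ∫ y in B, (π * σ ^ 2 / θ * ‖gradient u y‖ ^ 2 + θ / (4 * π) * ‖W y‖ ^ 2) := by
        refine integral_mono_ae ?_ ((hu.2.1.const_mul _).add (hW2.const_mul _)) ?_
        · refine Integrable.const_mul ?_ σ
          refine Integrable.mono' (hu.integrable_gradient.norm.mul_const (8 / s))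
            ((measurable_gradient u).aestronglyMeasurable.inner hWm.aestronglyMeasurable) ?_
          filter_upwards [ae_restrict_mem measurableSet_B] with y hy
          refine (norm_inner_le_norm _ _).trans ?_
          gcongr
          exact hWb y hy
        · refine Eventually.of_forall fun y => ?_
          have h1 : σ * inner ℝ (gradient u y) (W y) ≤ |σ| * (‖gradient u y‖ * ‖W y‖) := by
            refine (le_abs_self _).trans ?_
            rw [abs_mul]
            gcongr
            exact abs_real_inner_le_norm _ _
          refine h1.trans ?_
          have h2 : π * σ ^ 2 / θ * ‖gradient u y‖ ^ 2 + θ / (4 * π) * ‖W y‖ ^ 2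
              - |σ| * (‖gradient u y‖ * ‖W y‖)
              = (2 * π * |σ| * ‖gradient u y‖ - θ * ‖W y‖) ^ 2 / (4 * π * θ) := by
            rw [← sq_abs σ]; field_simp; ring
          have h3 : 0 ≤ (2 * π * |σ| * ‖gradient u y‖ - θ * ‖W y‖) ^ 2 / (4 * π * θ) := by positivity
          linarith
    _ = π * σ ^ 2 / θ * enormSq u + θ / (4 * π) * ∫ y in B, ‖W y‖ ^ 2 := by
        rw [integral_add (hu.2.1.const_mul _) (hW2.const_mul _), integral_const_mul,
          integral_const_mul, enormSq]
    _ ≤ π * σ ^ 2 / θ * 1 + θ / (4 * π) * (4 * π * E) := by gcongr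
    _ = π * σ ^ 2 / θ + θ * E := by field_simp

/-- Exponential integrability of regularised averages of `u`. -/
lemma IsH1.integral_exp_greenMass_le {μ : Measure Pt} [IsFiniteMeasure μ] (hu : IsH1 u)
    (hE : enormSq u ≤ 1) (hs : 0 < s) (hμ : ∀ᵐ x ∂μ, x ∈ B) {θ C : ℝ} (hθ : 0 < θ) (hC0 : 0 < C)
    (hC : ∀ y ∈ B, ∫ x, Real.exp (θ * green s x y) ∂μ ≤ C) (σ : ℝ) :
    Integrable (fun x => Real.exp (σ * ∫ y in B, u y * greenMass s x y)) μ ∧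
    ∫ x, Real.exp (σ * ∫ y in B, u y * greenMass s x y) ∂μ ≤ C * Real.exp (π * σ ^ 2 / θ) := by
  set U : Pt → ℝ := fun x => ∫ y in B, inner ℝ (gradient u y) (greenField s x y) with hU
  have hUm : StronglyMeasurable U := stronglyMeasurable_greenPotential hs
  have hae : (fun x => Real.exp (σ * U x)) =ᵐ[μ]
      fun x => Real.exp (σ * ∫ y in B, u y * greenMass s x y) := by
    filter_upwards [hμ] with x hx
    simp only [hU]
    rw [hu.integral_inner_greenField hs hx]
  rw [← integral_congr_ae hae, ← integrable_congr hae]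
  set b := ∫ y in B, ‖gradient u y‖ * (8 / s)
  have hVm : AEStronglyMeasurable (fun x => σ * U x) μ := (hUm.const_mul σ).aestronglyMeasurable
  have hVb : ∀ᵐ x ∂μ, ‖σ * U x‖ ≤ |σ| * b := by
    filter_upwards [hμ] with x hx
    rw [norm_mul, Real.norm_eq_abs σ]
    gcongr
    exact norm_greenPotential_le hu hs hx
  have hVi := integrable_exp_of_bound hVm hVb
  refine ⟨hVi, ?_⟩
  rcases eq_or_ne μ 0 with rfl | hμ0
  · simp only [integral_zero_measure]; positivity
  have : NeZero μ := ⟨hμ0⟩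
  have := isProbabilityMeasure_tilted hVi
  have hac := tilted_absolutelyContinuous μ fun x => σ * U x
  set Q := μ.tilted fun x => σ * U x with hQdef
  set Z := ∫ x, Real.exp (σ * U x) ∂μ with hZ
  have hZ0 : 0 < Z := integral_exp_pos hVi
  set E := ∫ x, σ * U x ∂Q - Real.log Z + Real.log C with hEdef
  have hG : ∀ y ∈ B, ∫ x, green s x y ∂Q ≤ E / θ := by
    intro y hy
    rw [le_div_iff₀' hθ, ← integral_const_mul]
    have hc : Continuous fun x => green s x y :=
      Continuous.comp (g := fun p : Pt × Pt => green s p.1 p.2) (f := fun x => (x, y))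
        (continuous_green hs) (by fun_prop)
    refine integral_tilted_le (b' := θ * (1 / s)) hVm (hc.const_mul θ).aestronglyMeasurable
      hVb ?_ hC0 (hC y hy)
    filter_upwards [hμ] with x hx
    rw [norm_mul, Real.norm_eq_abs, Real.norm_eq_abs, abs_of_pos hθ,
      abs_of_nonneg (green_nonneg hs hx hy)]
    gcongr
    exact green_le_inv hs hx hy
  have h1 := integral_greenPotential_le hu hE hs (hac.ae_le hμ) hθ hG σ
  rw [mul_div_cancel₀ _ hθ.ne', ← integral_const_mul] at h1
  have h2 : Real.log Z ≤ π * σ ^ 2 / θ + Real.log C := by linarith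
  rw [← Real.exp_log hZ0, ← Real.exp_log hC0, ← Real.exp_add, Real.exp_le_exp]
  linarith

end

/-- A truncated power singularity dominating `exp (θ * green s x y)` near the diagonal. -/
def singularProfile (θ : ℝ) : Pt → ℝ :=
  (Metric.ball 0 3).indicator fun w => 144 * (12 / ‖w‖ ^ 2) ^ θ

lemma singularProfile_nonneg (θ : ℝ) (w : Pt) : 0 ≤ singularProfile θ w :=
  indicator_nonneg (fun w _ => by positivity) w

lemma integrable_singularProfile {θ : ℝ} (hθ : θ < 1) : Integrable (singularProfile θ) := by
  refine (integrable_indicator_iff measurableSet_ball).2 ?_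
  refine integrableOn_ball_of_norm_le_rpow (C := 144 * 12 ^ θ) (α := 2 * θ) (by simp) ?_ ?_ ?_
  · simp only [finrank_euclideanSpace, Fintype.card_fin]; push_cast; linarith
  · refine Eventually.of_forall fun w => ?_
    rw [Real.norm_eq_abs, abs_of_nonneg (by positivity), Real.div_rpow (by norm_num) (by positivity),
      Real.rpow_neg (norm_nonneg _), Real.rpow_mul (norm_nonneg _), Real.rpow_two]
    exact le_of_eq (by ring)
  · exact Measurable.aestronglyMeasurable (by fun_prop)

lemma dens_mul_exp_green_le {θ s : ℝ} (hθ0 : 0 < θ) (hθ : θ < 1) (hs : 0 < s) {x y : Pt}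
    (hx : x ∈ B) (hy : y ∈ B) (hxy : x ≠ y) :
    dens x * Real.exp (θ * green s x y) ≤ 2 * dens x +
      ((1 - ‖y‖ ^ 2) ^ 2)⁻¹ * singularProfile θ ((1 - ‖y‖ ^ 2)⁻¹ • (x - y)) := by
  have hD : 0 < distQuad x y := by
    rw [distQuad_eq]; exact pow_pos (norm_pos_iff.2 (sub_ne_zero.2 hxy)) 2
  have hI := imageQuad_sub_distQuad x y
  have hp := one_sub_sq_pos hx
  have hq := one_sub_sq_pos hy
  set p := 1 - ‖x‖ ^ 2 with hpd
  set q := 1 - ‖y‖ ^ 2 with hqd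
  set D := distQuad x y with hDd
  have hgr : green s x y = Real.log ((D + p * q + s) / (D + s)) := by
    have : imageQuad x y = D + p * q := by linarith
    rw [green, this, Real.log_div (by positivity) (by positivity)]
  have hmono : ∀ t : ℝ, (D + p * q + s) / (D + s) ≤ t → Real.exp (θ * green s x y) ≤ t ^ θ := by
    intro t ht
    have h0 : 0 < (D + p * q + s) / (D + s) := by positivity
    rw [Real.rpow_def_of_pos (h0.trans_le ht), hgr, mul_comm]
    exact Real.exp_le_exp.2 (mul_le_mul_of_nonneg_right (Real.log_le_log h0 ht) hθ0.le)
  have hdn := dens_nonneg x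
  have hn2 := mul_nonneg (inv_nonneg.2 (sq_nonneg q)) (singularProfile_nonneg θ (q⁻¹ • (x - y)))
  rcases le_or_gt (p * q) D with hle | hlt
  · have h1 : Real.exp (θ * green s x y) ≤ 2 := by
      refine (hmono 2 ?_).trans ?_
      · rw [div_le_iff₀ (by positivity)]; linarith
      · exact (Real.rpow_le_rpow_of_exponent_le (by norm_num) hθ.le).trans_eq (Real.rpow_one 2)
    nlinarith
  · have hDn : D = ‖x - y‖ ^ 2 := distQuad_eq x y
    have hpq : |p - q| ≤ 2 * ‖x - y‖ := by
      have e : p - q = (‖y‖ - ‖x‖) * (‖y‖ + ‖x‖) := by rw [hpd, hqd]; ring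
      have h1 := abs_norm_sub_norm_le y x
      rw [norm_sub_rev] at h1
      rw [e, abs_mul, abs_of_nonneg (by positivity : 0 ≤ ‖y‖ + ‖x‖), mul_comm]
      have := mem_B_iff.1 hx
      have := mem_B_iff.1 hy
      gcongr
      linarith
    have hsq : (p - q) ^ 2 ≤ 4 * (p * q) := by
      rw [← sq_abs]
      calc |p - q| ^ 2 ≤ (2 * ‖x - y‖) ^ 2 := by gcongr
        _ = 4 * D := by rw [hDn]; ring
        _ ≤ 4 * (p * q) := by linarith
    have hp6 : p ≤ 6 * q := by by_contra! h; nlinarith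
    have hq6 : q ≤ 6 * p := by by_contra! h; nlinarith
    have hball : q⁻¹ • (x - y) ∈ Metric.ball (0 : Pt) 3 := by
      rw [mem_ball_zero_iff, norm_smul, norm_inv, Real.norm_eq_abs, abs_of_pos hq,
        inv_mul_lt_iff₀ hq]
      refine lt_of_pow_lt_pow_left₀ 2 (by positivity) ?_
      rw [← hDn]
      nlinarith
    have hval : singularProfile θ (q⁻¹ • (x - y)) = 144 * (12 * q ^ 2 / D) ^ θ := by
      rw [singularProfile, indicator_of_mem hball, norm_smul, norm_inv, Real.norm_eq_abs,
        abs_of_pos hq, mul_pow, ← hDn]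
      congr 2
      field_simp
    have hexp : Real.exp (θ * green s x y) ≤ (12 * q ^ 2 / D) ^ θ := by
      refine hmono _ ?_
      rw [div_le_div_iff₀ (by positivity) hD]
      have h6 : p * q ≤ 6 * q ^ 2 := by nlinarith
      have h7 : (D + p * q) * D ≤ 12 * q ^ 2 * D := by gcongr; linarith
      have h8 : s * D ≤ s * (12 * q ^ 2) := by gcongr; nlinarith
      linarith
    have hdens : dens x ≤ 144 * (q ^ 2)⁻¹ := by
      have : (12 / q) ^ 2 = 144 * (q ^ 2)⁻¹ := by field_simp; norm_num
      rw [← this, dens]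
      gcongr ?_ ^ 2
      rw [div_le_div_iff₀ hp hq]
      linarith
    calc dens x * Real.exp (θ * green s x y) ≤ 144 * (q ^ 2)⁻¹ * (12 * q ^ 2 / D) ^ θ := by gcongr
      _ = (q ^ 2)⁻¹ * singularProfile θ (q⁻¹ • (x - y)) := by rw [hval]; ring
      _ ≤ _ := by linarith

lemma integral_scaled_singularProfile {θ q : ℝ} (hq : 0 < q) (y : Pt) :
    ∫ x, (q ^ 2)⁻¹ * singularProfile θ (q⁻¹ • (x - y)) = ∫ w, singularProfile θ w := by
  rw [integral_const_mul, integral_sub_right_eq_self (fun z => singularProfile θ (q⁻¹ • z)),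
    Measure.integral_comp_smul, abs_of_pos (by positivity)]
  simp [hq.ne']

/-- The hyperbolic volume measure restricted to `A`. -/
def hypMeasure (A : Set Pt) : Measure Pt :=
  (volume.restrict A).withDensity fun x => ENNReal.ofReal (dens x)

lemma integral_hypMeasure (A : Set Pt) (φ : Pt → ℝ) :
    ∫ x, φ x ∂(hypMeasure A) = ∫ x in A, dens x * φ x := by
  rw [hypMeasure, integral_withDensity_eq_integral_toReal_smul measurable_dens.ennreal_ofReal
    (Eventually.of_forall fun _ => ENNReal.ofReal_lt_top)]
  simp only [ENNReal.toReal_ofReal (dens_nonneg _), smul_eq_mul]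

lemma lintegral_hypMeasure (A : Set Pt) {φ : Pt → ENNReal}
    (hφ : AEMeasurable φ (volume.restrict A)) :
    ∫⁻ x, φ x ∂(hypMeasure A) = ∫⁻ x in A, ENNReal.ofReal (dens x) * φ x :=
  lintegral_withDensity_eq_lintegral_mul₀ measurable_dens.ennreal_ofReal.aemeasurable hφ

lemma ae_mem_hypMeasure {A : Set Pt} (hA : MeasurableSet A) : ∀ᵐ x ∂(hypMeasure A), x ∈ A :=
  (withDensity_absolutelyContinuous _ _).ae_le (ae_restrict_mem hA)

lemma integral_exp_green_le {θ s m : ℝ} (hθ0 : 0 < θ) (hθ : θ < 1) (hs : 0 < s) {A : Set Pt}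
    (hA : MeasurableSet A) (hAB : A ⊆ B) (hi : IntegrableOn dens A) (hm : ∫ x in A, dens x ≤ m)
    {y : Pt} (hy : y ∈ B) :
    ∫ x, Real.exp (θ * green s x y) ∂(hypMeasure A) ≤ 2 * m + ∫ w, singularProfile θ w := by
  have hq := one_sub_sq_pos hy
  have hpi : Integrable
      fun x => ((1 - ‖y‖ ^ 2) ^ 2)⁻¹ * singularProfile θ ((1 - ‖y‖ ^ 2)⁻¹ • (x - y)) :=
    (((integrable_singularProfile hθ).comp_smul (inv_ne_zero hq.ne')).comp_sub_right y).const_mul _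
  rw [integral_hypMeasure]
  calc ∫ x in A, dens x * Real.exp (θ * green s x y)
      ≤ ∫ x in A, (2 * dens x +
          ((1 - ‖y‖ ^ 2) ^ 2)⁻¹ * singularProfile θ ((1 - ‖y‖ ^ 2)⁻¹ • (x - y))) := by
        refine integral_mono_of_nonneg (Eventually.of_forall fun x =>
          mul_nonneg (dens_nonneg _) (Real.exp_nonneg _))
          ((hi.const_mul 2).add hpi.integrableOn) ?_
        filter_upwards [ae_restrict_mem hA, ae_restrict_of_ae (Measure.ae_ne volume y)] with x hx hxy
        exact dens_mul_exp_green_le hθ0 hθ hs (hAB hx) hy hxy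
    _ = 2 * (∫ x in A, dens x) + ∫ x in A,
          ((1 - ‖y‖ ^ 2) ^ 2)⁻¹ * singularProfile θ ((1 - ‖y‖ ^ 2)⁻¹ • (x - y)) := by
        rw [integral_add (hi.const_mul 2) hpi.integrableOn, integral_const_mul]
    _ ≤ 2 * m + ∫ w, singularProfile θ w := by
        rw [← integral_scaled_singularProfile hq y]
        refine add_le_add (by linarith) (setIntegral_le_integral hpi (Eventually.of_forall fun x => ?_))
        exact mul_nonneg (by positivity) (singularProfile_nonneg _ _)

lemma lintegral_exp_quadratic {α : ℝ} (hα : 0 < α) (t : ℝ) :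
    ∫⁻ τ : ℝ, ENNReal.ofReal (Real.exp (τ * t) * Real.exp (-(1 / (4 * α)) * τ ^ 2))
      = ENNReal.ofReal (√(4 * π * α) * Real.exp (α * t ^ 2)) := by
  have e : ∀ τ : ℝ, Real.exp (τ * t) * Real.exp (-(1 / (4 * α)) * τ ^ 2)
      = Real.exp (-(1 / (4 * α)) * (τ - 2 * α * t) ^ 2) * Real.exp (α * t ^ 2) := fun τ => by
    rw [← Real.exp_add, ← Real.exp_add]
    congr 1
    field_simp
    ring
  have hi : Integrable fun τ : ℝ => Real.exp (-(1 / (4 * α)) * (τ - 2 * α * t) ^ 2)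
      * Real.exp (α * t ^ 2) :=
    ((integrable_exp_neg_mul_sq (b := 1 / (4 * α)) (by positivity)).comp_sub_right _).mul_const _
  simp_rw [e]
  rw [← ofReal_integral_eq_lintegral_ofReal hi (Eventually.of_forall fun _ => by positivity),
    integral_mul_const, integral_sub_right_eq_self (fun τ : ℝ => Real.exp (-(1 / (4 * α)) * τ ^ 2)),
    integral_gaussian]
  congr 4
  field_simp

section
variable {u : Pt → ℝ}

/-- The part of the disc where `u` is large. -/
def largeSet (u : Pt → ℝ) : Set Pt := {x ∈ B | 1 < |u x|}

lemma largeSet_subset : largeSet u ⊆ B := fun _ hx => hx.1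

lemma IsH1.measurableSet_largeSet (hu : IsH1 u) : MeasurableSet (largeSet u) :=
  (hu.1.continuousOn.abs.isOpen_inter_preimage isOpen_B isOpen_Ioi).measurableSet

lemma IsH1.dens_largeSet (hu : IsH1 u) (hE : enormSq u ≤ 1) :
    IntegrableOn dens (largeSet u) ∧ ∫ x in largeSet u, dens x ≤ 4 := by
  have hm := hu.measurableSet_largeSet
  have hle : ∀ x ∈ largeSet u, dens x ≤ u x ^ 2 * dens x := fun x hx => by
    have h1 : 1 ≤ u x ^ 2 := by rw [← sq_abs]; exact one_le_pow₀ hx.2.le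
    nlinarith [dens_nonneg x]
  have hi : IntegrableOn (fun x => u x ^ 2 * dens x) (largeSet u) :=
    IntegrableOn.mono_set hu.2.2 largeSet_subset
  have hid : IntegrableOn dens (largeSet u) := by
    refine Integrable.mono' hi measurable_dens.aestronglyMeasurable ?_
    filter_upwards [ae_restrict_mem hm] with x hx
    rw [Real.norm_eq_abs, abs_of_nonneg (dens_nonneg x)]
    exact hle x hx
  refine ⟨hid, ?_⟩
  calc ∫ x in largeSet u, dens x ≤ ∫ x in largeSet u, u x ^ 2 * dens x :=
        setIntegral_mono_on hid hi hm hle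
    _ ≤ ∫ x in B, u x ^ 2 * dens x :=
        setIntegral_mono_set hu.2.2
          (Eventually.of_forall fun x => mul_nonneg (sq_nonneg _) (dens_nonneg x))
          largeSet_subset.eventuallyLE
    _ ≤ 4 * enormSq u := hu.hardy
    _ ≤ 4 := by linarith

lemma IsH1.lintegral_exp_mul_le (hu : IsH1 u) (hE : enormSq u ≤ 1) {θ : ℝ} (hθ0 : 0 < θ)
    (hθ : θ < 1) (τ : ℝ) :
    ∫⁻ x, ENNReal.ofReal (Real.exp (τ * u x)) ∂(hypMeasure (largeSet u)) ≤
      ENNReal.ofReal ((2 * 4 + ∫ w, singularProfile θ w) *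
        Real.exp (1 / (16 * π * θ) * τ ^ 2)) := by
  obtain ⟨hid, hd4⟩ := hu.dens_largeSet hE
  have hm := hu.measurableSet_largeSet
  have hfin : IsFiniteMeasure (hypMeasure (largeSet u)) :=
    isFiniteMeasure_withDensity_ofReal hid.2
  have haeA := ae_mem_hypMeasure hm
  have hae : ∀ᵐ x ∂(hypMeasure (largeSet u)), x ∈ B := haeA.mono fun x hx => hx.1
  have hψ : 0 ≤ ∫ w, singularProfile θ w := integral_nonneg fun w => singularProfile_nonneg θ w
  have hC0 : 0 < 2 * 4 + ∫ w, singularProfile θ w := by linarith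
  have hπ := Real.pi_pos
  have hs : ∀ n : ℕ, 0 < ((((n : ℝ) + 1) ^ 2)⁻¹) := fun n => by positivity
  have hbd : ∀ n : ℕ, _ := fun n : ℕ => hu.integral_exp_greenMass_le hE (hs n) hae hθ0 hC0
    (fun y hy => integral_exp_green_le hθ0 hθ (hs n) hm largeSet_subset hid hd4 hy) (τ / (4 * π))
  have hlim : ∀ x ∈ B, Tendsto (fun n : ℕ => ENNReal.ofReal (Real.exp (τ / (4 * π) *
      ∫ y in B, u y * greenMass ((((n : ℝ) + 1) ^ 2)⁻¹) x y))) atTop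
      (nhds (ENNReal.ofReal (Real.exp (τ * u x)))) := by
    intro x hx
    have h1 := (hu.tendsto_integral_greenMass hx).comp
      (tendsto_atTop_add_const_right atTop (1 : ℝ) tendsto_natCast_atTop_atTop)
    have h2 := h1.const_mul (τ / (4 * π))
    have e : τ / (4 * π) * (4 * π * u x) = τ * u x := by field_simp
    rw [e] at h2
    exact ENNReal.tendsto_ofReal ((Real.continuous_exp.tendsto _).comp h2)
  calc ∫⁻ x, ENNReal.ofReal (Real.exp (τ * u x)) ∂(hypMeasure (largeSet u))
      = ∫⁻ x, liminf (fun n : ℕ => ENNReal.ofReal (Real.exp (τ / (4 * π) *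
          ∫ y in B, u y * greenMass ((((n : ℝ) + 1) ^ 2)⁻¹) x y))) atTop
          ∂(hypMeasure (largeSet u)) := by
        refine lintegral_congr_ae ?_
        filter_upwards [hae] with x hx using (hlim x hx).liminf_eq.symm
    _ ≤ liminf (fun n : ℕ => ∫⁻ x, ENNReal.ofReal (Real.exp (τ / (4 * π) *
          ∫ y in B, u y * greenMass ((((n : ℝ) + 1) ^ 2)⁻¹) x y))
          ∂(hypMeasure (largeSet u))) atTop :=
        lintegral_liminf_le' fun n => (hbd n).1.aestronglyMeasurable.aemeasurable.ennreal_ofReal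
    _ ≤ _ := by
        refine liminf_le_of_frequently_le' (Frequently.of_forall fun n => ?_)
        rw [← ofReal_integral_eq_lintegral_ofReal (hbd n).1
          (Eventually.of_forall fun _ => Real.exp_nonneg _)]
        refine ENNReal.ofReal_le_ofReal ((hbd n).2.trans_eq ?_)
        congr 2
        field_simp
        norm_num

/-- A Moser–Trudinger type inequality on the hyperbolic disc, away from small values. -/
theorem exists_lintegral_exp_sq_le {α : ℝ} (hα0 : 0 < α) (hα : α < 4 * π) :
    ∃ C : ℝ, 0 ≤ C ∧ ∀ u : Pt → ℝ, IsH1 u → enormSq u ≤ 1 →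
      ∫⁻ x in largeSet u, ENNReal.ofReal (Real.exp (α * u x ^ 2) * dens x) ≤ ENNReal.ofReal C := by
  have hπ := Real.pi_pos
  obtain ⟨θ, hθ1, hθ⟩ := exists_between ((div_lt_one (by positivity)).2 hα : α / (4 * π) < 1)
  have hθ0 : 0 < θ := lt_trans (by positivity) hθ1
  rw [div_lt_iff₀ (by positivity)] at hθ1
  set K := 2 * 4 + ∫ w, singularProfile θ w with hK
  have hψ : 0 ≤ ∫ w, singularProfile θ w := integral_nonneg fun w => singularProfile_nonneg θ w
  have hK0 : 0 < K := by linarith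
  set β := 1 / (4 * α) - 1 / (16 * π * θ) with hβ
  have hβ0 : 0 < β := by
    rw [hβ, sub_pos]
    exact one_div_lt_one_div_of_lt (by positivity) (by linarith)
  refine ⟨K * √(π / β) / √(4 * π * α), by positivity, fun u hu hE => ?_⟩
  set μ := hypMeasure (largeSet u) with hμ
  have hum : AEMeasurable u (volume.restrict (largeSet u)) :=
    (hu.aestronglyMeasurable.mono_set largeSet_subset).aemeasurable
  have hum' : AEMeasurable u μ := hum.mono_ac (withDensity_absolutelyContinuous _ _)
  have hfin : IsFiniteMeasure μ := isFiniteMeasure_withDensity_ofReal (hu.dens_largeSet hE).1.2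
  have hsq : 0 < √(4 * π * α) := by positivity
  have e1 : ∫⁻ x in largeSet u, ENNReal.ofReal (Real.exp (α * u x ^ 2) * dens x)
      = ∫⁻ x, ENNReal.ofReal (Real.exp (α * u x ^ 2)) ∂μ := by
    rw [hμ, lintegral_hypMeasure _ (by fun_prop)]
    refine lintegral_congr fun x => ?_
    rw [← ENNReal.ofReal_mul (dens_nonneg x), mul_comm]
  have e2 : ENNReal.ofReal √(4 * π * α) * ∫⁻ x, ENNReal.ofReal (Real.exp (α * u x ^ 2)) ∂μ
      ≤ ENNReal.ofReal (K * √(π / β)) := by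
    calc ENNReal.ofReal √(4 * π * α) * ∫⁻ x, ENNReal.ofReal (Real.exp (α * u x ^ 2)) ∂μ
        = ∫⁻ x, (∫⁻ τ : ℝ, ENNReal.ofReal
            (Real.exp (τ * u x) * Real.exp (-(1 / (4 * α)) * τ ^ 2))) ∂μ := by
          rw [← lintegral_const_mul' _ _ ENNReal.ofReal_ne_top]
          refine lintegral_congr fun x => ?_
          rw [lintegral_exp_quadratic hα0, ENNReal.ofReal_mul (Real.sqrt_nonneg _)]
      _ = ∫⁻ τ : ℝ, (∫⁻ x, ENNReal.ofReal
            (Real.exp (τ * u x) * Real.exp (-(1 / (4 * α)) * τ ^ 2)) ∂μ) := by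
          refine lintegral_lintegral_swap ?_
          have h1 : AEMeasurable (fun p : Pt × ℝ => u p.1) (μ.prod volume) := hum'.comp_fst
          have h2 : AEMeasurable (fun p : Pt × ℝ => p.2) (μ.prod volume) :=
            measurable_snd.aemeasurable
          exact (((h2.mul h1).exp).mul ((h2.pow_const 2).const_mul _).exp).ennreal_ofReal
      _ ≤ ∫⁻ τ : ℝ, ENNReal.ofReal (K * Real.exp (-β * τ ^ 2)) := by
          refine lintegral_mono fun τ => ?_
          simp_rw [ENNReal.ofReal_mul (Real.exp_nonneg _)]
          rw [lintegral_mul_const' _ _ ENNReal.ofReal_ne_top]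
          refine (mul_le_mul_left (hu.lintegral_exp_mul_le hE hθ0 hθ τ) _).trans_eq ?_
          rw [← ENNReal.ofReal_mul (by positivity), ← hK, mul_assoc, ← Real.exp_add, hβ]
          congr 3
          ring
      _ = ENNReal.ofReal (K * √(π / β)) := by
          rw [← ofReal_integral_eq_lintegral_ofReal
            ((integrable_exp_neg_mul_sq hβ0).const_mul K)
            (Eventually.of_forall fun _ => by positivity), integral_const_mul, integral_gaussian]
  rw [e1, ENNReal.ofReal_div_of_pos hsq]
  rw [ENNReal.le_div_iff_mul_le (Or.inl (by simpa using hsq)) (Or.inl ENNReal.ofReal_ne_top), mul_comm]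
  exact e2

end

lemma CriticalGrowth.exists_abs_fn_le {lam : ℝ} {h : Pt → ℝ → ℝ} (hf : CriticalGrowth lam h)
    {ε : ℝ} (hε : 0 < ε) :
    ∃ C, 0 ≤ C ∧ ∀ x ∈ B, ∀ t : ℝ,
      |fn lam h x t| ≤ C * Real.exp (ε * t ^ 2) * (Real.exp (lam * t ^ 2) - 1) := by
  obtain ⟨T, hT⟩ := hf.h_sup ε hε 1 one_pos
  obtain ⟨C, hC⟩ := hf.h_bdd (|T| + 1) (by positivity)
  have hnonneg : ∀ t : ℝ, 0 ≤ Real.exp (lam * t ^ 2) - 1 := fun t =>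
    sub_nonneg.2 (Real.one_le_exp (mul_nonneg hf.lam_pos.le (sq_nonneg t)))
  have hpos : ∀ x ∈ B, ∀ t : ℝ, 0 < t →
      |fn lam h x t| ≤ max C 1 * Real.exp (ε * t ^ 2) * (Real.exp (lam * t ^ 2) - 1) := by
    intro x hx t ht
    have hexp : 1 ≤ Real.exp (ε * t ^ 2) := Real.one_le_exp (by positivity)
    rw [fn, abs_mul, abs_of_nonneg (hnonneg t)]
    refine mul_le_mul_of_nonneg_right ?_ (hnonneg t)
    rcases le_total t T with htT | htT
    · calc |h x t| ≤ C := hC x hx t (by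
            rw [abs_of_pos ht]; exact htT.trans ((le_abs_self T).trans (by linarith)))
        _ ≤ max C 1 * 1 := by rw [mul_one]; exact le_max_left _ _
        _ ≤ _ := mul_le_mul_of_nonneg_left hexp (zero_le_one.trans (le_max_right _ _))
    · have h1 : 0 < h x t :=
        pos_of_mul_pos_left (hf.f_pos x hx t ht) (hnonneg t)
      have h2 := hT t htT x hx
      rw [neg_mul, Real.exp_neg, ← div_eq_mul_inv, div_lt_iff₀ (Real.exp_pos _)] at h2
      rw [abs_of_pos h1]
      exact h2.le.trans (mul_le_mul_of_nonneg_right (le_max_right _ _) (Real.exp_nonneg _))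
  refine ⟨max C 1, zero_le_one.trans (le_max_right _ _), fun x hx t => ?_⟩
  rcases lt_trichotomy t 0 with ht | rfl | ht
  · have := hpos x hx (-t) (neg_pos.2 ht)
    rwa [hf.f_odd x hx, abs_neg, neg_sq] at this
  · simp [fn]
  · exact hpos x hx t ht

lemma CriticalGrowth.exists_lintegral_le {lam : ℝ} {h : Pt → ℝ → ℝ} (hf : CriticalGrowth lam h)
    {c : ℝ} (hc : c ^ 2 < 4 * π / lam) :
    ∃ M : ℝ, ∀ u : Pt → ℝ, IsH1 u → enormSq u ≤ 1 →
      ∫⁻ x in B, ENNReal.ofReal (fn lam h x (c * u x) * u x * dens x) ≤ ENNReal.ofReal M := by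
  have hlam := hf.lam_pos
  rw [lt_div_iff₀ hlam] at hc
  set ε : ℝ := (4 * π - c ^ 2 * lam) / (2 * (c ^ 2 + 1)) with hεdef
  have hε : 0 < ε := div_pos (by linarith) (by positivity)
  have hε' : ε * (c ^ 2 + 1) = (4 * π - c ^ 2 * lam) / 2 := by
    rw [hεdef]; field_simp
  obtain ⟨C, hC0, hC⟩ := hf.exists_abs_fn_le hε
  set α : ℝ := (ε + lam) * c ^ 2 + ε with hα
  have hα0 : 0 < α := by positivity
  obtain ⟨K, hK0, hK⟩ := exists_lintegral_exp_sq_le hα0 (by rw [hα]; linarith)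
  set D : ℝ := C * Real.exp ((ε + lam) * c ^ 2) * (lam * c ^ 2) with hD
  have hD0 : 0 ≤ D := by positivity
  refine ⟨C / ε * K + D * 4, fun u hu hE => ?_⟩
  have hfn : ∀ x ∈ B, fn lam h x (c * u x) * u x ≤ C * Real.exp (ε * (c * u x) ^ 2) *
      (Real.exp (lam * (c * u x) ^ 2) - 1) * |u x| := fun x hx => by
    refine (le_abs_self _).trans ?_
    rw [abs_mul]
    exact mul_le_mul_of_nonneg_right (hC x hx _) (abs_nonneg _)
  have hlarge : ∫⁻ x in largeSet u, ENNReal.ofReal (fn lam h x (c * u x) * u x * dens x)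
      ≤ ENNReal.ofReal (C / ε * K) := by
    calc _ ≤ ∫⁻ x in largeSet u, ENNReal.ofReal (C / ε) *
            ENNReal.ofReal (Real.exp (α * u x ^ 2) * dens x) := by
          refine setLIntegral_mono' hu.measurableSet_largeSet fun x hx => ?_
          rw [← ENNReal.ofReal_mul (by positivity), ← mul_assoc]
          refine ENNReal.ofReal_le_ofReal (mul_le_mul_of_nonneg_right ?_ (dens_nonneg x))
          refine (hfn x hx.1).trans ?_
          have h1 : |u x| ≤ Real.exp (ε * u x ^ 2) / ε := by
            rw [le_div_iff₀ hε]
            have h2 := Real.add_one_le_exp (ε * u x ^ 2)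
            have h3 : |u x| ≤ u x ^ 2 := by rw [← sq_abs]; nlinarith [hx.2]
            nlinarith
          calc _ ≤ C * Real.exp (ε * (c * u x) ^ 2) * Real.exp (lam * (c * u x) ^ 2) *
                (Real.exp (ε * u x ^ 2) / ε) := by
                refine mul_le_mul (mul_le_mul_of_nonneg_left (by linarith) (by positivity)) h1
                  (abs_nonneg _) (by positivity)
            _ = C / ε * Real.exp (α * u x ^ 2) := by
                have : α * u x ^ 2 = ε * (c * u x) ^ 2 + lam * (c * u x) ^ 2 + ε * u x ^ 2 := by
                  rw [hα]; ring
                rw [this, Real.exp_add, Real.exp_add]; ring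
      _ = ENNReal.ofReal (C / ε) *
            ∫⁻ x in largeSet u, ENNReal.ofReal (Real.exp (α * u x ^ 2) * dens x) :=
          lintegral_const_mul' _ _ ENNReal.ofReal_ne_top
      _ ≤ _ := by
          rw [ENNReal.ofReal_mul (by positivity)]
          gcongr
          exact hK u hu hE
  have hsmall : ∫⁻ x in B \ largeSet u, ENNReal.ofReal (fn lam h x (c * u x) * u x * dens x)
      ≤ ENNReal.ofReal (D * 4) := by
    calc _ ≤ ∫⁻ x in B \ largeSet u, ENNReal.ofReal D * ENNReal.ofReal (u x ^ 2 * dens x) := by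
          refine setLIntegral_mono' (measurableSet_B.diff hu.measurableSet_largeSet) fun x hx => ?_
          rw [← ENNReal.ofReal_mul hD0, ← mul_assoc]
          refine ENNReal.ofReal_le_ofReal (mul_le_mul_of_nonneg_right ?_ (dens_nonneg x))
          refine (hfn x hx.1).trans ?_
          have h1 : |u x| ≤ 1 := not_lt.1 fun h => hx.2 ⟨hx.1, h⟩
          have h2 : u x ^ 2 ≤ 1 := (sq_le_one_iff_abs_le_one _).2 h1
          have h3 : Real.exp (lam * (c * u x) ^ 2) - 1
              ≤ lam * (c * u x) ^ 2 * Real.exp (lam * (c * u x) ^ 2) := by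
            have h4 := Real.add_one_le_exp (-(lam * (c * u x) ^ 2))
            have h5 := mul_le_mul_of_nonneg_right h4 (Real.exp_nonneg (lam * (c * u x) ^ 2))
            rw [← Real.exp_add, neg_add_cancel, Real.exp_zero] at h5
            linarith
          calc _ ≤ C * Real.exp (ε * (c * u x) ^ 2) *
                (lam * (c * u x) ^ 2 * Real.exp (lam * (c * u x) ^ 2)) * 1 := by
                refine mul_le_mul (mul_le_mul_of_nonneg_left h3 (by positivity)) h1
                  (abs_nonneg _) (by positivity)
            _ = C * Real.exp ((ε + lam) * c ^ 2 * u x ^ 2) * (lam * c ^ 2) * u x ^ 2 := by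
                have : (ε + lam) * c ^ 2 * u x ^ 2 = ε * (c * u x) ^ 2 + lam * (c * u x) ^ 2 := by
                  ring
                rw [this, Real.exp_add]; ring
            _ ≤ D * u x ^ 2 := by
                rw [hD]
                refine mul_le_mul_of_nonneg_right (mul_le_mul_of_nonneg_right
                  (mul_le_mul_of_nonneg_left (Real.exp_le_exp.2 ?_) hC0) (by positivity))
                  (sq_nonneg _)
                exact mul_le_of_le_one_right (by positivity) h2
      _ = ENNReal.ofReal D * ∫⁻ x in B \ largeSet u, ENNReal.ofReal (u x ^ 2 * dens x) :=
          lintegral_const_mul' _ _ ENNReal.ofReal_ne_top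
      _ ≤ ENNReal.ofReal D * ∫⁻ x in B, ENNReal.ofReal (u x ^ 2 * dens x) := by
          gcongr
          exact sdiff_subset
      _ = ENNReal.ofReal D * ENNReal.ofReal (hInt fun x => u x ^ 2) := by
          rw [hInt, ofReal_integral_eq_lintegral_ofReal hu.2.2
            (Eventually.of_forall fun x => mul_nonneg (sq_nonneg _) (dens_nonneg x))]
      _ ≤ _ := by
          rw [← ENNReal.ofReal_mul hD0]
          refine ENNReal.ofReal_le_ofReal (mul_le_mul_of_nonneg_left ?_ hD0)
          linarith [hu.hardy]
  have hB : B = largeSet u ∪ B \ largeSet u := (union_sdiff_cancel largeSet_subset).symm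
  rw [ENNReal.ofReal_add (by positivity) (by positivity)]
  conv_lhs => rw [hB]
  exact (lintegral_union_le _ _ _).trans (add_le_add hlarge hsmall)

lemma zero_mem_B : (0 : Pt) ∈ B := by simp [mem_B_iff]

lemma IsH1.gradient_const_mul {u : Pt → ℝ} (hu : IsH1 u) (a : ℝ) {x : Pt} (hx : x ∈ B) :
    gradient (fun y => a * u y) x = a • gradient u x := by
  have h1 : DifferentiableAt ℝ u x := hu.1.differentiableAt (isOpen_B.mem_nhds hx)
  simp [gradient, fderiv_const_mul h1]

lemma IsH1.const_mul {u : Pt → ℝ} (hu : IsH1 u) (a : ℝ) : IsH1 fun y => a * u y := by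
  refine ⟨hu.1.const_mul a, ?_, ?_⟩
  · refine IntegrableOn.congr_fun (Integrable.const_mul hu.2.1 (a ^ 2)) (fun x hx => ?_) measurableSet_B
    simp only [hu.gradient_const_mul a hx, norm_smul, mul_pow, Real.norm_eq_abs, sq_abs]
  · refine (Integrable.const_mul hu.2.2 (a ^ 2)).congr (Eventually.of_forall fun x => ?_)
    simp only
    ring

lemma IsH1.enormSq_const_mul {u : Pt → ℝ} (hu : IsH1 u) (a : ℝ) :
    enormSq (fun y => a * u y) = a ^ 2 * enormSq u := by
  rw [enormSq, enormSq, ← integral_const_mul]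
  refine setIntegral_congr_fun measurableSet_B fun x hx => ?_
  simp only [hu.gradient_const_mul a hx, norm_smul, mul_pow, Real.norm_eq_abs, sq_abs]

lemma green_zero (s : ℝ) (y : Pt) :
    green s 0 y = Real.log (1 + s) - Real.log (‖y‖ ^ 2 + s) := by
  simp [green, imageQuad, distQuad, planeQuad]

lemma enormSq_green_zero_le {s : ℝ} (hs : 0 < s) :
    enormSq (green s 0) ≤ (Real.log (1 + s) - Real.log s) * (4 * π) := by
  have hg := isH1_green hs zero_mem_B
  have hle : ∀ y, green s 0 y ≤ Real.log (1 + s) - Real.log s := fun y => by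
    rw [green_zero]
    have := Real.log_le_log hs (show s ≤ ‖y‖ ^ 2 + s by linarith [sq_nonneg ‖y‖])
    linarith
  have h1 : enormSq (green s 0) = ∫ y in B, green s 0 y * greenMass s 0 y := by
    rw [← hg.integral_inner_greenField hs zero_mem_B, enormSq]
    refine integral_congr_ae (Eventually.of_forall fun y => ?_)
    simp only [gradient_green_eq hs, real_inner_self_eq_norm_sq]
  have hL : 0 ≤ Real.log (1 + s) - Real.log s :=
    sub_nonneg.2 (Real.log_le_log hs (by linarith))
  have hcont : Continuous (green s 0) := by
    refine continuous_iff_continuousAt.2 fun y => (gradient_green hs 0 y).continuousAt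
  have hi : ∀ {g : Pt → ℝ}, Continuous g → IntegrableOn g B := fun hg' =>
    (hg'.continuousOn.integrableOn_compact (isCompact_closedBall (0 : Pt) 1)).mono_set
      Metric.ball_subset_closedBall
  rw [h1]
  calc _ ≤ ∫ y in B, (Real.log (1 + s) - Real.log s) * greenMass s 0 y := by
        refine setIntegral_mono_on (hi (hcont.mul (continuous_greenMass_right hs 0)))
          (hi ((continuous_greenMass_right hs 0).const_mul _)) measurableSet_B fun y hy => ?_
        exact mul_le_mul_of_nonneg_right (hle y) (greenMass_nonneg hs zero_mem_B hy)
    _ ≤ _ := by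
        rw [integral_const_mul]
        exact mul_le_mul_of_nonneg_left (integral_greenMass_le hs zero_mem_B) hL

/-- A Moser-type concentrating function of energy at most one. -/
lemma exists_concentrating {L : ℝ} (hL : 4 ≤ L) :
    ∃ s : ℝ, Real.exp (-L) ≤ s ∧ s ≤ 1 / 4 ∧ ∃ u : Pt → ℝ, IsH1 u ∧ enormSq u ≤ 1 ∧
      ∀ y, ‖y‖ ^ 2 ≤ s → 0 ≤ u y ∧ (L - 2) / (4 * π) ≤ u y ^ 2 := by
  have hexp : 5 ≤ Real.exp L := by linarith [Real.add_one_le_exp L]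
  set s : ℝ := 1 / (Real.exp L - 1) with hs
  have hs0 : 0 < s := one_div_pos.2 (by linarith)
  have hlog : Real.log (1 + s) - Real.log s = L := by
    rw [← Real.log_div (by linarith) hs0.ne']
    have : (1 + s) / s = Real.exp L := by
      have : Real.exp L - 1 ≠ 0 := by linarith
      rw [hs]; field_simp; ring
    rw [this, Real.log_exp]
  have hg := isH1_green hs0 zero_mem_B
  have hL0 : 0 < 4 * π * L := by positivity
  have ha : (√(4 * π * L))⁻¹ ^ 2 = (4 * π * L)⁻¹ := by rw [inv_pow, Real.sq_sqrt hL0.le]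
  refine ⟨s, ?_, ?_, fun y => (√(4 * π * L))⁻¹ * green s 0 y, hg.const_mul _, ?_, fun y hy => ?_⟩
  · rw [Real.exp_neg, hs, one_div]
    exact inv_anti₀ (by linarith) (by linarith)
  · exact one_div_le_one_div_of_le (by norm_num) (by linarith)
  · rw [hg.enormSq_const_mul, ha, inv_mul_le_iff₀ hL0]
    refine (enormSq_green_zero_le hs0).trans ?_
    rw [hlog]; linarith
  · have h1 : L - 1 ≤ green s 0 y := by
      rw [green_zero]
      have h2 : Real.log (‖y‖ ^ 2 + s) ≤ Real.log (2 * s) :=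
        Real.log_le_log (by positivity) (by linarith)
      rw [Real.log_mul two_ne_zero hs0.ne'] at h2
      linarith [Real.log_two_lt_d9]
    refine ⟨mul_nonneg (by positivity) (by linarith), ?_⟩
    rw [mul_pow, ha, inv_mul_eq_div, div_le_div_iff₀ (by positivity) hL0]
    have h3 : (L - 2) * L ≤ green s 0 y ^ 2 := by nlinarith
    nlinarith [Real.pi_pos, mul_le_mul_of_nonneg_left h3 (by positivity : 0 ≤ 4 * π)]

lemma CriticalGrowth.sq_le_of_lintegral_le {lam : ℝ} {h : Pt → ℝ → ℝ} (hf : CriticalGrowth lam h)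
    {c M : ℝ} (hc : 0 ≤ c)
    (hM : ∀ u : Pt → ℝ, IsH1 u → enormSq u ≤ 1 →
      ∫⁻ x in B, ENNReal.ofReal (fn lam h x (c * u x) * u x * dens x) ≤ ENNReal.ofReal M) :
    c ^ 2 ≤ 4 * π / lam := by
  have hlam := hf.lam_pos
  by_contra! hlt
  rw [div_lt_iff₀ hlam] at hlt
  have hc0 : 0 < c := by
    rcases hc.eq_or_lt with rfl | h0
    · exfalso; nlinarith [Real.pi_pos]
    · exact h0
  set ε : ℝ := (c ^ 2 * lam - 4 * π) / (2 * c ^ 2) with hεdef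
  set η : ℝ := (c ^ 2 * lam - 4 * π) / (8 * π) with hη
  have hε : 0 < ε := div_pos (by linarith) (by positivity)
  have hη0 : 0 < η := div_pos (by linarith) (by positivity)
  have hrate : (lam - ε) * c ^ 2 = 4 * π * (1 + η) := by
    rw [hεdef, hη]; field_simp; ring
  have hB : Metric.closedBall (0 : Pt) (1 / 2) ⊆ B :=
    Metric.closedBall_subset_ball (by norm_num)
  obtain ⟨T, hT⟩ := hf.h_inf ε hε _ hB (isCompact_closedBall _ _) 1
  have hm : Tendsto (fun L : ℝ => (L - 2) / (4 * π)) atTop atTop :=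
    (tendsto_atTop_add_const_right _ (-2) tendsto_id).atTop_div_const (by positivity)
  have hr : Tendsto (fun L : ℝ => 2 * π * Real.exp (η * L - 2 * (1 + η))) atTop atTop :=
    (Real.tendsto_exp_atTop.comp (tendsto_atTop_add_const_right _ (-(2 * (1 + η)))
      (tendsto_id.const_mul_atTop hη0))).const_mul_atTop (by positivity)
  obtain ⟨L, hL4, hm1, hmT, hmexp, hLM⟩ := ((eventually_ge_atTop 4).and
    ((hm.eventually_ge_atTop 1).and ((hm.eventually_ge_atTop ((T / c) ^ 2)).and
      ((hm.eventually_ge_atTop (1 / (lam * c ^ 2))).and (hr.eventually_gt_atTop |M|))))).exists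
  obtain ⟨s, hs, hs4, u, hu, hE, hlow⟩ := exists_concentrating hL4
  have hs0 : 0 < s := (Real.exp_pos _).trans_le hs
  have hpt : ∀ y ∈ Metric.closedBall (0 : Pt) √s,
      2 * Real.exp ((1 + η) * (L - 2)) ≤ fn lam h y (c * u y) * u y * dens y := by
    intro y hy
    rw [mem_closedBall_zero_iff] at hy
    have hy2 : ‖y‖ ^ 2 ≤ s := by
      rw [← Real.sq_sqrt hs0.le]; exact pow_le_pow_left₀ (norm_nonneg y) hy 2
    have hyK : y ∈ Metric.closedBall (0 : Pt) (1 / 2) := by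
      rw [mem_closedBall_zero_iff]
      refine hy.trans ?_
      rw [Real.sqrt_le_left (by norm_num)]
      linarith
    obtain ⟨hu0, hum⟩ := hlow y hy2
    have hu1 : 1 ≤ u y := by nlinarith
    have hTt : T ≤ c * u y := by
      rw [← div_le_iff₀' hc0]
      exact le_of_abs_le (abs_le_of_sq_le_sq (hmT.trans hum) hu0)
    have hlamt : 1 ≤ lam * (c * u y) ^ 2 := by
      have := hmexp.trans hum
      rw [div_le_iff₀ (by positivity)] at this
      linarith
    have hh : Real.exp (-(ε * (c * u y) ^ 2)) ≤ h y (c * u y) := by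
      have := hT _ hTt y hyK
      rw [Real.exp_neg, inv_le_iff_one_le_mul₀ (Real.exp_pos _)]
      exact this
    have hexp : Real.exp (lam * (c * u y) ^ 2) / 2 ≤ Real.exp (lam * (c * u y) ^ 2) - 1 := by
      have := Real.add_one_le_exp (lam * (c * u y) ^ 2)
      linarith
    calc 2 * Real.exp ((1 + η) * (L - 2))
        ≤ 2 * Real.exp ((lam - ε) * c ^ 2 * u y ^ 2) := by
          rw [hrate]
          rw [div_le_iff₀ (by positivity)] at hum
          have : (1 + η) * (L - 2) ≤ (1 + η) * (u y ^ 2 * (4 * π)) :=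
            mul_le_mul_of_nonneg_left hum (by positivity)
          exact mul_le_mul_of_nonneg_left (Real.exp_le_exp.2 (by linarith)) zero_le_two
      _ = Real.exp (-(ε * (c * u y) ^ 2)) * (Real.exp (lam * (c * u y) ^ 2) / 2) * 1 * 4 := by
          have : (lam - ε) * c ^ 2 * u y ^ 2 = -(ε * (c * u y) ^ 2) + lam * (c * u y) ^ 2 := by
            ring
          rw [this, Real.exp_add]; ring
      _ ≤ fn lam h y (c * u y) * u y * dens y := by
          have h1 : Real.exp (-(ε * (c * u y) ^ 2)) * (Real.exp (lam * (c * u y) ^ 2) / 2)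
              ≤ fn lam h y (c * u y) :=
            mul_le_mul hh hexp (by positivity) ((Real.exp_nonneg _).trans hh)
          have h0 : 0 ≤ fn lam h y (c * u y) := le_trans (by positivity) h1
          exact mul_le_mul (mul_le_mul h1 hu1 zero_le_one h0) (four_le_dens (hB hyK))
            (by norm_num) (mul_nonneg h0 hu0)
  have hsub : Metric.closedBall (0 : Pt) √s ⊆ B := by
    refine (Metric.closedBall_subset_closedBall ?_).trans hB
    exact (Real.sqrt_le_left (by norm_num)).2 (by linarith)
  have hvol : volume (Metric.closedBall (0 : Pt) √s) = ENNReal.ofReal (s * π) := by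
    rw [EuclideanSpace.volume_closedBall_fin_two, ← ENNReal.ofReal_pow (Real.sqrt_nonneg _),
      Real.sq_sqrt hs0.le, ENNReal.ofReal_mul hs0.le]
  have hInteg : ENNReal.ofReal (2 * Real.exp ((1 + η) * (L - 2)) * (s * π)) ≤ ENNReal.ofReal |M| :=
    calc _ = ∫⁻ _ in Metric.closedBall (0 : Pt) √s,
            ENNReal.ofReal (2 * Real.exp ((1 + η) * (L - 2))) := by
          rw [setLIntegral_const, hvol, ← ENNReal.ofReal_mul (by positivity)]
      _ ≤ ∫⁻ y in Metric.closedBall (0 : Pt) √s,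
            ENNReal.ofReal (fn lam h y (c * u y) * u y * dens y) :=
          setLIntegral_mono' Metric.isClosed_closedBall.measurableSet fun y hy =>
            ENNReal.ofReal_le_ofReal (hpt y hy)
      _ ≤ ∫⁻ y in B, ENNReal.ofReal (fn lam h y (c * u y) * u y * dens y) :=
          lintegral_mono_set hsub
      _ ≤ _ := (hM u hu hE).trans (ENNReal.ofReal_le_ofReal (le_abs_self M))
  rw [ENNReal.ofReal_le_ofReal_iff (abs_nonneg M)] at hInteg
  have hfinal : 2 * π * Real.exp (η * L - 2 * (1 + η))
      ≤ 2 * Real.exp ((1 + η) * (L - 2)) * (s * π) := by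
    have : η * L - 2 * (1 + η) = (1 + η) * (L - 2) + -L := by ring
    rw [this, Real.exp_add]
    have := mul_le_mul_of_nonneg_left hs
      (by positivity : 0 ≤ 2 * π * Real.exp ((1 + η) * (L - 2)))
    linarith
  linarith

/-- For `f` of critical growth satisfying also (C5) and (C6), the nonradial
critical threshold:
`sup { c² : sup_{u ∈ H¹(𝔹²), ‖u‖ ≤ 1} ∫_B f(x,cu)u dv_g < ∞ } = 4π/λ`. -/
theorem stmt18 (lam : ℝ) (h : Pt → ℝ → ℝ) (hf : CriticalGrowth lam h)
    (hC5 : CondC5 h) (hC6 : CondC6 h) :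
    sSup {c2 : ℝ | ∃ c : ℝ, 0 ≤ c ∧ c2 = c ^ 2 ∧
        ∃ M : ℝ, ∀ u : Pt → ℝ, IsH1 u → enormSq u ≤ 1 →
          ∫⁻ x in B, ENNReal.ofReal (fn lam h x (c * u x) * u x * dens x)
            ≤ ENNReal.ofReal M}
      = 4 * π / lam := by
  have hpos : 0 < 4 * π / lam := div_pos (by positivity) hf.lam_pos
  have hmem : ∀ w, 0 ≤ w → w < 4 * π / lam → ∃ c : ℝ, 0 ≤ c ∧ w = c ^ 2 ∧
      ∃ M : ℝ, ∀ u : Pt → ℝ, IsH1 u → enormSq u ≤ 1 →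
        ∫⁻ x in B, ENNReal.ofReal (fn lam h x (c * u x) * u x * dens x) ≤ ENNReal.ofReal M :=
    fun w hw hlt => ⟨√w, Real.sqrt_nonneg w, (Real.sq_sqrt hw).symm,
      hf.exists_lintegral_le (by rwa [Real.sq_sqrt hw])⟩
  refine csSup_eq_of_forall_le_of_forall_lt_exists_gt ⟨0, hmem 0 le_rfl hpos⟩ ?_ fun w hw => ?_
  · rintro _ ⟨c, hc, rfl, M, hM⟩
    exact hf.sq_le_of_lintegral_le hc hM
  · obtain ⟨v, hv1, hv2⟩ := exists_between (max_lt hw hpos)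
    exact ⟨v, hmem v ((le_max_right _ _).trans hv1.le) hv2, (le_max_left _ _).trans_lt hv1⟩
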